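/- arXiv:1503.02091 — 2 statements merged into one kernel-verified Lean document; each statement's English description precedes it below -/
import Mathlib

section
/- Let k, m ≥ 2. The pure trace algebra C_km coincides with the center of the mixed trace algebra T_km; moreover, C_km is a finitely generated K-algebra and T_km is a finitely generated C_km-module. -/
open scoped BigOperators
noncomputable section

/-- `Ω = K[y_pq^(i)]`, matrices over the polynomial ring in `k²m` variables. -/
abbrev Mat (K : Type) [Field K] (k m : ℕ) :=
  Matrix (Fin k) (Fin k) (MvPolynomial (Fin m × Fin k × Fin k) K)

/-- The generic `k × k` matrices `y_i = (y_pq^(i))`. -/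
def genY (K : Type) [Field K] (k m : ℕ) (i : Fin m) : Mat K k m :=
  Matrix.of fun p q => MvPolynomial.X (i, p, q)

/-- The scalar matrix `f · I` for `f ∈ Ω`. -/
def scalarOf (K : Type) [Field K] (k m : ℕ)
    (f : MvPolynomial (Fin m × Fin k × Fin k) K) : Mat K k m :=
  algebraMap _ _ f

/-- `R_km`: the generic matrix algebra, generated by `y_1, …, y_m`. -/
def Rkm (K : Type) [Field K] (k m : ℕ) : Subalgebra K (Mat K k m) :=
  Algebra.adjoin K (Set.range (genY K k m))

/-- `C_km`: the pure trace algebra, generated by the `tr(y_{i_1} ⋯ y_{i_l}) · I`, `l ≥ 1`. -/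
def Ckm (K : Type) [Field K] (k m : ℕ) : Subalgebra K (Mat K k m) :=
  Algebra.adjoin K
    {x | ∃ (l : ℕ) (w : Fin (l + 1) → Fin m),
      x = scalarOf K k m (Matrix.trace ((List.ofFn fun j => genY K k m (w j)).prod))}

/-- `T_km`: the mixed trace algebra, generated by `R_km ∪ C_km`. -/
def Tkm (K : Type) [Field K] (k m : ℕ) : Subalgebra K (Mat K k m) :=
  Rkm K k m ⊔ Ckm K k m

/-- The generic traceless matrices `z_i = y_i - (1/k)·tr(y_i)·I`. -/
def genZ (K : Type) [Field K] (k m : ℕ) (i : Fin m) : Mat K k m :=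
  genY K k m i - (k : K)⁻¹ • scalarOf K k m (Matrix.trace (genY K k m i))

/-- `W_km`: the algebra generated by the generic traceless matrices `z_1, …, z_m`. -/
def Wkm (K : Type) [Field K] (k m : ℕ) : Subalgebra K (Mat K k m) :=
  Algebra.adjoin K (Set.range (genZ K k m))

/-- `C_km⁰`: the algebra generated by the `tr(z_{i_1} ⋯ z_{i_l}) · I`, `l ≥ 1`. -/
def Ckm0 (K : Type) [Field K] (k m : ℕ) : Subalgebra K (Mat K k m) :=
  Algebra.adjoin K
    {x | ∃ (l : ℕ) (w : Fin (l + 1) → Fin m),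
      x = scalarOf K k m (Matrix.trace ((List.ofFn fun j => genZ K k m (w j)).prod))}

/-- `T_km⁰`: the algebra generated by `W_km ∪ C_km⁰`. -/
def Tkm0 (K : Type) [Field K] (k m : ℕ) : Subalgebra K (Mat K k m) :=
  Wkm K k m ⊔ Ckm0 K k m

/-- The subspace of matrices all of whose entries have total degree at most `n`,
i.e. `M_k(Ω_{≤n})`. -/
def degLE (K : Type) [Field K] (k m n : ℕ) : Submodule K (Mat K k m) where
  carrier := {a | ∀ p q, (a p q).totalDegree ≤ n}
  add_mem' := by
    intro a b ha hb p q
    calc ((a + b) p q).totalDegree = (a p q + b p q).totalDegree := by simp [Matrix.add_apply]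
    _ ≤ max (a p q).totalDegree (b p q).totalDegree := MvPolynomial.totalDegree_add _ _
    _ ≤ n := max_le (ha p q) (hb p q)
  zero_mem' := by intro p q; simp
  smul_mem' := by
    intro c a ha p q
    calc ((c • a) p q).totalDegree = (c • a p q).totalDegree := by simp [Matrix.smul_apply]
    _ ≤ (a p q).totalDegree := MvPolynomial.totalDegree_smul_le _ _
    _ ≤ n := ha p q

/-- Degree-one part of the expansion of `(a + t b) ^ n` for a scalar parameter `t`. -/
theorem exists_coeff_add_smul_pow {K A : Type*} [Field K] [Ring A] [Algebra K A] (a b : A)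
    (n : ℕ) : ∃ c : ℕ → A, (∀ t : K, (a + t • b) ^ n = ∑ j ∈ Finset.range (n + 1), t ^ j • c j) ∧
      c 0 = a ^ n ∧ c 1 = ∑ i ∈ Finset.range n, a ^ i * b * a ^ (n - 1 - i) := by
  induction n with
  | zero => exact ⟨fun j => if j = 0 then 1 else 0, by simp, by simp, by simp⟩
  | succ n ih =>
    obtain ⟨c, hc, h0, h1⟩ := ih
    refine ⟨fun j => (if j ≤ n then a * c j else 0) + (if j = 0 then 0 else b * c (j - 1)),
      fun t => ?_, ?_, ?_⟩
    · rw [pow_succ', hc, add_mul, Finset.mul_sum, Finset.mul_sum]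
      simp only [smul_add, Finset.sum_add_distrib]
      congr 1
      · rw [Finset.sum_range_succ _ (n + 1)]
        simp only [add_le_iff_nonpos_right, nonpos_iff_eq_zero, one_ne_zero, if_false, smul_zero,
          add_zero, mul_smul_comm]
        refine Finset.sum_congr rfl fun j hj => ?_
        rw [if_pos (by simpa [Nat.lt_succ_iff] using hj)]
      · rw [Finset.sum_range_succ' _ (n + 1)]
        simp [smul_smul, pow_succ]
    · simp [h0, pow_succ']
    · rw [Finset.sum_range_succ']
      simp only [one_ne_zero, if_false, Nat.sub_self, h0]
      rcases n with _ | n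
      · simp
      · simp only [h1, Nat.le_add_left, if_true, Finset.mul_sum, pow_zero, one_mul]
        congr 1
        refine Finset.sum_congr rfl fun i hi => ?_
        have : n + 1 + 1 - 1 - (i + 1) = n + 1 - 1 - i := by omega
        rw [this, pow_succ']
        simp only [mul_assoc]

/-- A polynomial expression in a scalar parameter with all values in a subspace has all its
coefficients in that subspace. -/
theorem Submodule.coeff_mem_of_forall_sum_pow_smul_mem {K M : Type*} [Field K] [CharZero K]
    [AddCommGroup M] [Module K M] (J : Submodule K M) (n : ℕ) (c : ℕ → M)
    (h : ∀ t : K, ∑ j ∈ Finset.range n, t ^ j • c j ∈ J) {j : ℕ} (hj : j < n) : c j ∈ J := by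
  rw [← Submodule.Quotient.mk_eq_zero, ← Module.forall_dual_apply_eq_zero_iff K]
  intro φ
  set p : Polynomial K :=
    ∑ j ∈ Finset.range n, Polynomial.monomial j (φ (Submodule.Quotient.mk (c j))) with hp
  have hp0 : p = 0 := by
    refine Polynomial.funext fun t => ?_
    have := (Submodule.Quotient.mk_eq_zero J).2 (h t)
    have h2 := congrArg φ this
    rw [← Submodule.mkQ_apply, map_sum, map_sum, map_zero] at h2
    rw [hp, Polynomial.eval_finsetSum, Polynomial.eval_zero, ← h2]
    refine Finset.sum_congr rfl fun i _ => ?_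
    simp [mul_comm]
  have := congrArg (fun q => Polynomial.coeff q j) hp0
  simpa [hp, Polynomial.finsetSum_coeff, Polynomial.coeff_monomial, hj] using this

/-- Linearization of the identity `x ^ (k + 1) ≡ 0` modulo a subspace. -/
theorem sum_pow_mul_mul_pow_mem {K A : Type*} [Field K] [CharZero K] [Ring A] [Algebra K A]
    (B J : Submodule K A) (k : ℕ) (h : ∀ b ∈ B, b ^ (k + 1) ∈ J) {a b : A} (ha : a ∈ B)
    (hb : b ∈ B) : ∑ i ∈ Finset.range (k + 1), a ^ i * b * a ^ (k - i) ∈ J := by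
  obtain ⟨c, hc, -, h1⟩ := exists_coeff_add_smul_pow (K := K) a b (k + 1)
  have := J.coeff_mem_of_forall_sum_pow_smul_mem (k + 1 + 1) c
    (fun t => hc t ▸ h _ (B.add_mem ha (B.smul_mem t hb))) (j := 1) (by omega)
  simpa [h1] using this

theorem Submodule.pow_mem_of_mul_le {K A : Type*} [Field K] [Ring A] [Algebra K A]
    {B : Submodule K A} (hB : B * B ≤ B) {b : A} (hb : b ∈ B) (n : ℕ) : b ^ (n + 1) ∈ B := by
  induction n with
  | zero => simpa
  | succ n ih => rw [pow_succ]; exact hB (Submodule.mul_mem_mul ih hb)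

theorem pow_mul_mul_pow_mem {K A : Type*} [Field K] [CharZero K] [Ring A] [Algebra K A]
    (B J : Submodule K A) (hB : B * B ≤ B) (hBJ : B * J ≤ J) (hJB : J * B ≤ J) (k : ℕ)
    (h : ∀ b ∈ B, b ^ (k + 1) ∈ J) {a b c : A} (ha : a ∈ B) (hb : b ∈ B) (hc : c ∈ B) :
    a ^ k * c * b ^ k ∈ J := by
  have key : ∑ j ∈ Finset.range (k + 1),
      (∑ i ∈ Finset.range (k + 1), a ^ i * (c * b ^ j) * a ^ (k - i)) * b ^ (k - j) ∈ J := by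
    refine Submodule.sum_mem _ fun j _ => ?_
    have hcb : c * b ^ j ∈ B := by
      rcases j with _ | j
      · simpa
      · exact hB (Submodule.mul_mem_mul hc (Submodule.pow_mem_of_mul_le hB hb j))
    have := sum_pow_mul_mul_pow_mem B J k h ha hcb
    rcases hkj : k - j with _ | l
    · simpa using this
    · exact hJB (Submodule.mul_mem_mul this (Submodule.pow_mem_of_mul_le hB hb l))
  have e : ∑ j ∈ Finset.range (k + 1),
      (∑ i ∈ Finset.range (k + 1), a ^ i * (c * b ^ j) * a ^ (k - i)) * b ^ (k - j) =
      ∑ i ∈ Finset.range (k + 1), a ^ i * c *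
        ∑ j ∈ Finset.range (k + 1), b ^ j * a ^ (k - i) * b ^ (k - j) := by
    simp only [Finset.sum_mul, Finset.mul_sum]
    rw [Finset.sum_comm]
    simp only [mul_assoc]
  rw [e, Finset.sum_range_succ] at key
  have h1 : ∑ i ∈ Finset.range k, a ^ i * c *
        ∑ j ∈ Finset.range (k + 1), b ^ j * a ^ (k - i) * b ^ (k - j) ∈ J := by
    refine Submodule.sum_mem _ fun i hi => ?_
    have hac : a ^ i * c ∈ B := by
      rcases i with _ | i
      · simpa
      · exact hB (Submodule.mul_mem_mul (Submodule.pow_mem_of_mul_le hB ha i) hc)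
    obtain ⟨l, hl⟩ : ∃ l, k - i = l + 1 := ⟨k - i - 1, by have := Finset.mem_range.1 hi; omega⟩
    refine hBJ (Submodule.mul_mem_mul hac (sum_pow_mul_mul_pow_mem B J k h hb ?_))
    rw [hl]
    exact Submodule.pow_mem_of_mul_le hB ha l
  have h2 := (Submodule.add_mem_iff_right _ h1).1 key
  have h3 : ∑ j ∈ Finset.range (k + 1), b ^ j * a ^ (k - k) * b ^ (k - j)
      = ((k + 1 : ℕ) : K) • b ^ k := by
    rw [Nat.cast_smul_eq_nsmul, Finset.sum_congr rfl (g := fun _ => b ^ k), Finset.sum_const,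
      Finset.card_range]
    intro j hj
    have := Finset.mem_range.1 hj
    rw [Nat.sub_self, pow_zero, mul_one, ← pow_add]
    congr 1
    omega
  rw [h3, mul_smul_comm] at h2
  exact (Submodule.smul_mem_iff _ (Nat.cast_ne_zero.2 k.succ_ne_zero)).1 h2

/-- **Nagata–Higman**: a nil algebra of bounded index in characteristic zero is nilpotent. -/
theorem nagata_higman {K A : Type*} [Field K] [CharZero K] [Ring A] [Algebra K A]
    (B : Submodule K A) (hB : B * B ≤ B) (k : ℕ) (J : Submodule K A) (hJ : J ≤ B)
    (hBJ : B * J ≤ J) (hJB : J * B ≤ J) (h : ∀ b ∈ B, b ^ (k + 1) ∈ J) :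
    ∃ N : ℕ, B ^ (N + 1) ≤ J := by
  induction k generalizing J with
  | zero => exact ⟨0, fun b hb => by simpa using h b (by simpa using hb)⟩
  | succ k ih =>
    set S : Set A := {x | ∃ b ∈ B, x = b ^ (k + 1)}
    set P : Submodule K A := Submodule.span K S with hP
    have hPB : P ≤ B := Submodule.span_le.2 fun x ⟨b, hb, hx⟩ =>
      hx ▸ Submodule.pow_mem_of_mul_le hB hb k
    set U : Submodule K A := 1 + B with hU
    have hBU : B * U ≤ B := by
      rw [hU, mul_add, mul_one]; exact sup_le le_rfl hB
    have hUB : U * B ≤ B := by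
      rw [hU, add_mul, one_mul]; exact sup_le le_rfl hB
    have hUJ : U * J ≤ J := by
      rw [hU, add_mul, one_mul]; exact sup_le le_rfl hBJ
    have hJU : J * U ≤ J := by
      rw [hU, mul_add, mul_one]; exact sup_le le_rfl hJB
    have h1U : 1 ≤ U := le_sup_left
    have hBleU : B ≤ U := le_sup_right
    set Q : Submodule K A := U * P * U with hQ
    have hPQ : P ≤ Q := by
      calc P = 1 * P * 1 := by simp
        _ ≤ U * P * U := by gcongr
    have hQB : Q ≤ B := calc
      Q ≤ U * B * U := by rw [hQ]; gcongr
      _ ≤ B * U := by gcongr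
      _ ≤ B := hBU
    have hPBP : P * B * P ≤ J := by
      rw [hP]
      nth_rw 1 [← Submodule.span_eq B]
      rw [Submodule.span_mul_span, Submodule.span_mul_span, Submodule.span_le]
      rintro _ ⟨_, ⟨_, ⟨a, ha, rfl⟩, c, hc, rfl⟩, _, ⟨b, hb, rfl⟩, rfl⟩
      exact pow_mul_mul_pow_mem B J hB hBJ hJB (k + 1) h ha hb hc
    obtain ⟨N, hN⟩ := ih (J + Q) (sup_le hJ hQB)
      (by
        rw [mul_add]
        refine sup_le_sup hBJ ?_
        rw [hQ, ← mul_assoc, ← mul_assoc]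
        gcongr
        exact hBU.trans hBleU)
      (by
        rw [add_mul]
        refine sup_le_sup hJB ?_
        rw [hQ, mul_assoc _ U]
        gcongr
        exact hUB.trans hBleU)
      (fun b hb => le_sup_right (a := J) (hPQ (Submodule.subset_span ⟨b, hb, rfl⟩)))
    have hJQB : J + Q ≤ B := sup_le hJ hQB
    refine ⟨N + 1 + (N + 1), ?_⟩
    calc B ^ (N + 1 + (N + 1) + 1) = B ^ (N + 1) * B * B ^ (N + 1) := by
          rw [← pow_succ, ← pow_add]; congr 1; omega
      _ ≤ (J + Q) * B * (J + Q) := by gcongr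
      _ ≤ J := by
        rw [add_mul, add_mul, mul_add (Q * B)]
        refine sup_le ?_ (sup_le ?_ ?_)
        · calc J * B * (J + Q) ≤ J * B * B := by gcongr
            _ ≤ J * B := by gcongr
            _ ≤ J := hJB
        · calc Q * B * J ≤ B * B * J := by gcongr
            _ ≤ B * J := by gcongr
            _ ≤ J := hBJ
        · calc Q * B * Q = U * (P * (U * B * U) * P) * U := by simp only [hQ, mul_assoc]
            _ ≤ U * (P * (B * U) * P) * U := by gcongr
            _ ≤ U * (P * B * P) * U := by gcongr
            _ ≤ U * J * U := by gcongr
            _ ≤ J * U := by gcongr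
            _ ≤ J := hJU

open Polynomial in
/-- The derivative of a determinant, column by column. -/
theorem Matrix.derivative_det {n R : Type*} [Fintype n] [DecidableEq n] [CommRing R]
    (M : Matrix n n R[X]) :
    derivative M.det = ∑ j, (M.updateCol j fun i => derivative (M i j)).det := by
  simp only [Matrix.det_apply', derivative_sum]
  rw [Finset.sum_comm]
  refine Finset.sum_congr rfl fun σ _ => ?_
  rw [← Finset.mul_sum, derivative_mul, derivative_intCast, zero_mul, zero_add,
    derivative_prod_finset]
  congr 1
  refine Finset.sum_congr rfl fun j _ => ?_
  rw [← Finset.prod_erase_mul _ _ (Finset.mem_univ j), Matrix.updateCol_self]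
  congr 1
  refine Finset.prod_congr rfl fun i hi => ?_
  rw [Matrix.updateCol_ne (Finset.ne_of_mem_erase hi)]

open Polynomial in
theorem Matrix.derivative_charpoly {n R : Type*} [Fintype n] [DecidableEq n] [CommRing R]
    (a : Matrix n n R) : derivative a.charpoly = (adjugate a.charmatrix).trace := by
  rw [Matrix.charpoly, Matrix.derivative_det, Matrix.trace]
  refine Finset.sum_congr rfl fun j _ => ?_
  have h : adjugate a.charmatrix j j = (adjugate a.charmatrix.transpose) j j := by
    rw [← Matrix.adjugate_transpose, Matrix.transpose_apply]
  rw [Matrix.diag_apply, h, Matrix.adjugate_apply, Matrix.updateRow_transpose,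
    Matrix.det_transpose]
  congr 2
  ext i
  by_cases h : i = j
  · subst h; simp
  · simp [h]

open Polynomial in
/-- In characteristic zero, the lower coefficients of the characteristic polynomial of `a` lie in
every nonunital subalgebra containing the traces of the powers of `a`. -/
theorem Matrix.coeff_charpoly_mem_of_trace_pow_mem {K R n : Type*} [Field K] [CharZero K]
    [Fintype n] [DecidableEq n] [CommRing R] [Nontrivial R] [Algebra K R]
    (S : NonUnitalSubalgebra K R) (a : Matrix n n R) (h : ∀ j, (a ^ (j + 1)).trace ∈ S) {i : ℕ}
    (hi : i ≠ Fintype.card n) : a.charpoly.coeff i ∈ S := by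
  set p := a.charpoly with hp
  set b : ℕ → Matrix n n R := fun i => (adjugate a.charmatrix).map fun q => q.coeff i with hb
  have hmul : a.charmatrix * adjugate a.charmatrix = p • (1 : Matrix n n R[X]) :=
    Matrix.mul_adjugate _
  have hmul' : ∀ r s, X * adjugate a.charmatrix r s - ∑ l, C (a r l) * adjugate a.charmatrix l s
      = p * (1 : Matrix n n R[X]) r s := by
    intro r s
    have := congrFun (congrFun hmul r) s
    rw [Matrix.mul_apply, Matrix.smul_apply, smul_eq_mul] at this
    rw [← this]
    simp only [Matrix.charmatrix_apply, sub_mul, Finset.sum_sub_distrib]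
    simp [Matrix.diagonal_apply]
  have hone : ∀ i r s, (p * (1 : Matrix n n R[X]) r s).coeff i
      = p.coeff i * (1 : Matrix n n R) r s := by
    intro i r s
    by_cases hrs : r = s
    · subst hrs; simp
    · simp [Matrix.one_apply_ne hrs]
  have hrec : ∀ i, b i = a * b (i + 1) + p.coeff (i + 1) • (1 : Matrix n n R) := by
    intro i
    ext r s
    have := congrArg (fun q => coeff q (i + 1)) (hmul' r s)
    simp only [coeff_sub, coeff_X_mul, finsetSum_coeff, coeff_C_mul, hone] at this
    rw [Matrix.add_apply, Matrix.smul_apply, smul_eq_mul, ← this, Matrix.mul_apply]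
    simp [hb]
  have hzero : a * b 0 + p.coeff 0 • (1 : Matrix n n R) = 0 := by
    ext r s
    have := congrArg (fun q => coeff q 0) (hmul' r s)
    simp only [coeff_sub, mul_coeff_zero, coeff_X_zero, zero_mul, finsetSum_coeff, coeff_C_zero,
      hone] at this
    rw [Matrix.add_apply, Matrix.smul_apply, smul_eq_mul, ← this, Matrix.mul_apply]
    simp [hb]
  have htr : ∀ i, (b i).trace = ((i + 1 : ℕ) : K) • p.coeff (i + 1) := by
    intro i
    have := congrArg (fun q => coeff q i) (Matrix.derivative_charpoly a)
    simp only [coeff_derivative, Matrix.trace, finsetSum_coeff] at this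
    rw [Algebra.smul_def, map_natCast, Nat.cast_add_one, mul_comm, hp, this]
    rfl
  have hone_tr : ∀ r : R, (r • (1 : Matrix n n R)).trace = (Fintype.card n : K) • r := by
    intro r
    rw [Matrix.trace_smul, Matrix.trace_one, smul_eq_mul, Algebra.smul_def, map_natCast, mul_comm]
  have hcoeff : ∀ i, (a * b (i + 1)).trace ∈ S → i + 1 ≠ Fintype.card n → p.coeff (i + 1) ∈ S := by
    intro i hi hne
    have e : (((i + 1 : ℕ) : K) - (Fintype.card n : K)) • p.coeff (i + 1)
        = (a * b (i + 1)).trace := by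
      rw [sub_smul, ← htr, hrec i, Matrix.trace_add, hone_tr]
      simp
    have hne' : ((i + 1 : ℕ) : K) - (Fintype.card n : K) ≠ 0 :=
      sub_ne_zero.2 (Nat.cast_injective.ne hne)
    rw [← inv_smul_smul₀ hne' (p.coeff (i + 1)), e]
    exact S.toSubmodule.smul_mem _ hi
  obtain ⟨D, hD⟩ : ∃ D, ∀ i, D ≤ i → b i = 0 := by
    refine ⟨(∑ r, ∑ s, (adjugate a.charmatrix r s).natDegree) + 1, fun i hi => ?_⟩
    ext r s
    refine coeff_eq_zero_of_natDegree_lt ?_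
    have h1 := Finset.single_le_sum (f := fun s => (adjugate a.charmatrix r s).natDegree)
      (fun _ _ => Nat.zero_le _) (Finset.mem_univ s)
    have h2 := Finset.single_le_sum (f := fun r => ∑ s, (adjugate a.charmatrix r s).natDegree)
      (fun _ _ => Nat.zero_le _) (Finset.mem_univ r)
    exact lt_of_le_of_lt (h1.trans h2) hi
  have main : ∀ d i, D ≤ i + d → ∀ j, (a ^ (j + 1) * b i).trace ∈ S := by
    intro d
    induction d with
    | zero => intro i hi j; rw [hD i hi]; simp
    | succ d ih =>
      intro i hi j
      have ih' := ih (i + 1) (by omega)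
      rw [hrec, mul_add, ← mul_assoc, ← pow_succ, Matrix.trace_add, mul_smul_comm, mul_one,
        Matrix.trace_smul, smul_eq_mul]
      refine S.add_mem (ih' _) ?_
      by_cases hc : i + 1 = Fintype.card n
      · have : p.coeff (i + 1) = 1 := by
          rw [hc, ← a.charpoly_natDegree_eq_dim]
          exact a.charpoly_monic.coeff_natDegree
        rw [this, one_mul]
        exact h j
      · exact S.mul_mem (hcoeff i (by simpa using ih' 0) hc) (h j)
  have main' : ∀ i, (a * b i).trace ∈ S := fun i => by simpa using main D i (by omega) 0
  rcases i with _ | i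
  · have hne' : (Fintype.card n : K) ≠ 0 := Nat.cast_ne_zero.2 hi.symm
    have e := congrArg Matrix.trace hzero
    rw [Matrix.trace_add, hone_tr, Matrix.trace_zero] at e
    rw [← inv_smul_smul₀ hne' (p.coeff 0), eq_neg_of_add_eq_zero_right e]
    exact S.toSubmodule.smul_mem _ (S.toSubmodule.neg_mem (main' 0))
  · exact hcoeff i (main' _) hi

section TraceMonomials

variable (K : Type) [Field K] (k m : ℕ)

/-- The value of a word at the generic matrices. -/
def wordMat (w : List (Fin m)) : Mat K k m := (w.map (genY K k m)).prod

/-- The product of the traces of the words in a list. -/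
def traceProd (L : List (List (Fin m))) : MvPolynomial (Fin m × Fin k × Fin k) K :=
  (L.map fun u => (wordMat K k m u).trace).prod

/-- The trace monomials: products of traces of nonempty words, times a word. -/
def traceMon (L : List (List (Fin m))) (w : List (Fin m)) : Mat K k m :=
  traceProd K k m L • wordMat K k m w

/-- The span of the trace monomials satisfying a given condition. -/
def traceSpan (P : List (List (Fin m)) → List (Fin m) → Prop) : Submodule K (Mat K k m) :=
  Submodule.span K {x | ∃ L w, (∀ u ∈ L, u ≠ []) ∧ P L w ∧ x = traceMon K k m L w}

/-- The nonunital algebra of pure trace polynomials without constant term. -/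
def traceIdealSpan : Submodule K (MvPolynomial (Fin m × Fin k × Fin k) K) :=
  Submodule.span K {f | ∃ L, (∀ u ∈ L, u ≠ []) ∧ L ≠ [] ∧ f = traceProd K k m L}

variable {K k m}

theorem wordMat_nil : wordMat K k m [] = 1 := rfl

theorem wordMat_append (u v : List (Fin m)) :
    wordMat K k m (u ++ v) = wordMat K k m u * wordMat K k m v := by
  simp [wordMat]

theorem wordMat_cons (i : Fin m) (v : List (Fin m)) :
    wordMat K k m (i :: v) = genY K k m i * wordMat K k m v := by
  simp [wordMat]

theorem traceProd_append (L L' : List (List (Fin m))) :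
    traceProd K k m (L ++ L') = traceProd K k m L * traceProd K k m L' := by
  simp [traceProd]

theorem traceProd_singleton (w : List (Fin m)) :
    traceProd K k m [w] = (wordMat K k m w).trace := by
  simp [traceProd]

theorem traceMon_nil_left (w : List (Fin m)) : traceMon K k m [] w = wordMat K k m w := by
  simp [traceMon, traceProd]

theorem traceMon_mul (L L' : List (List (Fin m))) (w w' : List (Fin m)) :
    traceMon K k m L w * traceMon K k m L' w' = traceMon K k m (L ++ L') (w ++ w') := by
  simp [traceMon, traceProd_append, wordMat_append, smul_smul, mul_comm]

theorem trace_traceMon (L : List (List (Fin m))) (w : List (Fin m)) :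
    (traceMon K k m L w).trace = traceProd K k m L * (wordMat K k m w).trace := by
  simp [traceMon, Matrix.trace_smul]

theorem traceMon_mem_traceSpan {P : List (List (Fin m)) → List (Fin m) → Prop}
    {L : List (List (Fin m))} {w : List (Fin m)} (hL : ∀ u ∈ L, u ≠ []) (h : P L w) :
    traceMon K k m L w ∈ traceSpan K k m P :=
  Submodule.subset_span ⟨L, w, hL, h, rfl⟩

theorem traceSpan_mono {P Q : List (List (Fin m)) → List (Fin m) → Prop}
    (h : ∀ L w, P L w → Q L w) : traceSpan K k m P ≤ traceSpan K k m Q :=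
  Submodule.span_mono fun _ ⟨L, w, hL, hP, hx⟩ => ⟨L, w, hL, h L w hP, hx⟩

theorem traceSpan_mul_le {P Q R : List (List (Fin m)) → List (Fin m) → Prop}
    (h : ∀ L w L' w', P L w → Q L' w' → R (L ++ L') (w ++ w')) :
    traceSpan K k m P * traceSpan K k m Q ≤ traceSpan K k m R := by
  rw [traceSpan, traceSpan, Submodule.span_mul_span, Submodule.span_le]
  rintro _ ⟨_, ⟨L, w, hL, hP, rfl⟩, _, ⟨L', w', hL', hQ, rfl⟩, rfl⟩
  simp only [traceMon_mul]
  refine traceMon_mem_traceSpan (fun u hu => ?_) (h _ _ _ _ hP hQ)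
  rcases List.mem_append.1 hu with hu | hu
  exacts [hL u hu, hL' u hu]

theorem traceIdealSpan_mul_le :
    traceIdealSpan K k m * traceIdealSpan K k m ≤ traceIdealSpan K k m := by
  rw [traceIdealSpan, Submodule.span_mul_span, Submodule.span_le]
  rintro _ ⟨_, ⟨L, hL, hne, rfl⟩, _, ⟨L', hL', -, rfl⟩, rfl⟩
  refine Submodule.subset_span ⟨L ++ L', fun u hu => ?_, by simp [hne], ?_⟩
  · rcases List.mem_append.1 hu with hu | hu
    exacts [hL u hu, hL' u hu]
  · simp [traceProd_append]

theorem trace_mem_traceIdealSpan {a : Mat K k m}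
    (ha : a ∈ traceSpan K k m fun L w => L ≠ [] ∨ w ≠ []) : a.trace ∈ traceIdealSpan K k m := by
  induction ha using Submodule.span_induction with
  | mem x hx =>
    obtain ⟨L, w, hL, h, rfl⟩ := hx
    rw [trace_traceMon]
    by_cases hw : w = []
    · subst hw
      have : (wordMat K k m []).trace = algebraMap K _ (k : K) := by
        simp [wordMat_nil]
      rw [this, mul_comm, ← Algebra.smul_def]
      exact Submodule.smul_mem _ _ (Submodule.subset_span ⟨L, hL, by simpa using h, rfl⟩)
    · rw [← traceProd_singleton, ← traceProd_append]
      refine Submodule.subset_span ⟨L ++ [w], fun u hu => ?_, by simp, rfl⟩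
      rcases List.mem_append.1 hu with hu | hu
      · exact hL u hu
      · exact (List.mem_singleton.1 hu) ▸ hw
  | zero => simp
  | add x y _ _ hx hy => rw [Matrix.trace_add]; exact Submodule.add_mem _ hx hy
  | smul c x _ hx => rw [Matrix.trace_smul]; exact Submodule.smul_mem _ _ hx

theorem traceIdealSpan_smul_mem {f : MvPolynomial (Fin m × Fin k × Fin k) K}
    (hf : f ∈ traceIdealSpan K k m) {a : Mat K k m}
    (ha : a ∈ traceSpan K k m fun _ _ => True) :
    f • a ∈ traceSpan K k m fun L _ => L ≠ [] := by
  induction hf using Submodule.span_induction with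
  | mem f hf =>
    obtain ⟨L, hL, hne, rfl⟩ := hf
    have h1 : traceMon K k m L [] ∈ traceSpan K k m fun L _ => L ≠ [] :=
      traceMon_mem_traceSpan hL hne
    have h2 := (traceSpan_mul_le (K := K) (k := k) (P := fun L _ => L ≠ []) (Q := fun _ _ => True)
      (R := fun L _ => L ≠ []) (by simp +contextual)) (Submodule.mul_mem_mul h1 ha)
    simpa [traceMon, wordMat_nil] using h2
  | zero => simp
  | add x y _ _ hx hy => rw [add_smul]; exact Submodule.add_mem _ hx hy
  | smul c x _ hx => rw [smul_assoc]; exact Submodule.smul_mem _ _ hx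

theorem pow_mem_traceSpan [CharZero K] {a : Mat K k m}
    (ha : a ∈ traceSpan K k m fun L w => L ≠ [] ∨ w ≠ []) :
    a ^ k ∈ traceSpan K k m fun L _ => L ≠ [] := by
  have hB : (traceSpan K k m fun L w => L ≠ [] ∨ w ≠ []) *
      (traceSpan K k m fun L w => L ≠ [] ∨ w ≠ [])
      ≤ traceSpan K k m fun L w => L ≠ [] ∨ w ≠ [] :=
    traceSpan_mul_le fun L w L' w' h _ => by
      rcases h with h | h <;> simp [h]
  let S : NonUnitalSubalgebra K (MvPolynomial (Fin m × Fin k × Fin k) K) :=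
    { traceIdealSpan K k m with
      mul_mem' := fun hx hy => traceIdealSpan_mul_le (Submodule.mul_mem_mul hx hy) }
  have htr : ∀ j, (a ^ (j + 1)).trace ∈ S := fun j =>
    trace_mem_traceIdealSpan (Submodule.pow_mem_of_mul_le hB ha j)
  have hcoeff : ∀ i < k, a.charpoly.coeff i ∈ traceIdealSpan K k m := fun i hi =>
    Matrix.coeff_charpoly_mem_of_trace_pow_mem S a htr (by simpa using hi.ne)
  have hpow : ∀ j, a ^ j ∈ traceSpan K k m fun _ _ => True := by
    rintro (_ | j)
    · rw [pow_zero, ← wordMat_nil, ← traceMon_nil_left]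
      exact traceMon_mem_traceSpan (by simp) trivial
    · exact traceSpan_mono (fun _ _ _ => trivial) (Submodule.pow_mem_of_mul_le hB ha j)
  have hdeg : a.charpoly.natDegree = k := by simp
  have hCH := a.aeval_self_charpoly
  rw [Polynomial.aeval_eq_sum_range, hdeg, Finset.sum_range_succ] at hCH
  have hlead : a.charpoly.coeff k = 1 := by
    have h := a.charpoly_monic.coeff_natDegree
    rwa [hdeg] at h
  rw [hlead, one_smul] at hCH
  rw [eq_neg_of_add_eq_zero_right hCH]
  exact Submodule.neg_mem _ (Submodule.sum_mem _ fun i hi =>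
    traceIdealSpan_smul_mem (hcoeff i (Finset.mem_range.1 hi)) (hpow i))

theorem exists_wordMat_mem_traceSpan [CharZero K] (hk : 1 ≤ k) :
    ∃ N : ℕ, ∀ w : List (Fin m), N ≤ w.length →
      wordMat K k m w ∈ traceSpan K k m fun L _ => L ≠ [] := by
  obtain ⟨k, rfl⟩ : ∃ l, k = l + 1 := ⟨k - 1, by omega⟩
  set B := traceSpan K (k + 1) m fun L w => L ≠ [] ∨ w ≠ []
  set J := traceSpan K (k + 1) m fun L _ => L ≠ []
  have hJB : J * B ≤ J := traceSpan_mul_le fun L w L' w' h _ => by simp [h]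
  obtain ⟨N, hN⟩ := nagata_higman B
    (traceSpan_mul_le fun L w L' w' h _ => by rcases h with h | h <;> simp [h]) k J
    (traceSpan_mono fun _ _ h => Or.inl h)
    (traceSpan_mul_le fun L w L' w' _ h => by simp [h]) hJB (fun b hb => pow_mem_traceSpan hb)
  have hpow : ∀ n, N + 1 ≤ n → B ^ n ≤ J := by
    intro n hn
    induction n, hn using Nat.le_induction with
    | base => exact hN
    | succ n _ ih =>
      rw [pow_succ]
      exact (mul_le_mul' ih le_rfl).trans hJB
  refine ⟨N + 1, fun w hw => hpow _ hw ?_⟩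
  clear hw
  induction w with
  | nil => simp [wordMat_nil, ← Submodule.one_le]
  | cons i w ih =>
    rw [wordMat_cons, List.length_cons, pow_succ']
    refine Submodule.mul_mem_mul ?_ ih
    have : genY K (k + 1) m i = traceMon K (k + 1) m [] [i] := by
      simp [traceMon_nil_left, wordMat]
    rw [this]
    exact traceMon_mem_traceSpan (by simp) (by simp)


theorem wordMat_isHomogeneous (w : List (Fin m)) (p q : Fin k) :
    (wordMat K k m w p q).IsHomogeneous w.length := by
  induction w generalizing p q with
  | nil =>
    rw [wordMat_nil, Matrix.one_apply]
    split_ifs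
    · exact MvPolynomial.isHomogeneous_one _ _
    · exact MvPolynomial.isHomogeneous_zero _ _ _
  | cons i w ih =>
    rw [wordMat_cons, Matrix.mul_apply, List.length_cons, add_comm]
    exact MvPolynomial.IsHomogeneous.sum _ _ _ fun r _ =>
      (MvPolynomial.isHomogeneous_X K (i, p, r)).mul (ih r q)

theorem traceProd_isHomogeneous (L : List (List (Fin m))) :
    (traceProd K k m L).IsHomogeneous (L.map List.length).sum := by
  induction L with
  | nil => simpa [traceProd] using MvPolynomial.isHomogeneous_one _ _
  | cons u L ih =>
    rw [← List.singleton_append, traceProd_append, traceProd_singleton, List.map_append,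
      List.sum_append]
    refine MvPolynomial.IsHomogeneous.mul ?_ ih
    simp only [List.map_singleton, List.sum_singleton]
    exact MvPolynomial.IsHomogeneous.sum _ _ _ fun r _ => wordMat_isHomogeneous u r r

theorem map_homogeneousComponent_mem_traceSpan {P : List (List (Fin m)) → List (Fin m) → Prop}
    (d : ℕ) {a : Mat K k m} (ha : a ∈ traceSpan K k m P) :
    a.map (MvPolynomial.homogeneousComponent d) ∈
      traceSpan K k m fun L w => P L w ∧ (L.map List.length).sum + w.length = d := by
  induction ha using Submodule.span_induction with
  | mem x hx =>
    obtain ⟨L, w, hL, h, rfl⟩ := hx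
    have hom : ∀ p q, (traceMon K k m L w p q).IsHomogeneous
        ((L.map List.length).sum + w.length) := fun p q =>
      (traceProd_isHomogeneous L).mul (wordMat_isHomogeneous w p q)
    by_cases hd : (L.map List.length).sum + w.length = d
    · have : (traceMon K k m L w).map (MvPolynomial.homogeneousComponent d)
          = traceMon K k m L w := by
        ext1 p q
        rw [Matrix.map_apply, MvPolynomial.homogeneousComponent_of_mem (hom p q), if_pos hd.symm]
      rw [this]
      exact traceMon_mem_traceSpan hL ⟨h, hd⟩
    · have : (traceMon K k m L w).map (MvPolynomial.homogeneousComponent d) = 0 := by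
        ext1 p q
        rw [Matrix.map_apply, MvPolynomial.homogeneousComponent_of_mem (hom p q),
          if_neg (Ne.symm hd), Matrix.zero_apply]
      rw [this]
      exact Submodule.zero_mem _
  | zero =>
    rw [Matrix.map_zero _ (map_zero _)]
    exact Submodule.zero_mem _
  | add x y _ _ hx hy =>
    rw [Matrix.map_add _ (map_add _)]
    exact Submodule.add_mem _ hx hy
  | smul c x _ hx =>
    rw [Matrix.map_smul _ _ (map_smul _ c)]
    exact Submodule.smul_mem _ _ hx

theorem wordMat_mem_traceSpan_length {w : List (Fin m)}
    (h : wordMat K k m w ∈ traceSpan K k m fun L _ => L ≠ []) :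
    wordMat K k m w ∈ traceSpan K k m fun L v =>
      L ≠ [] ∧ (L.map List.length).sum + v.length = w.length := by
  convert map_homogeneousComponent_mem_traceSpan w.length h using 1
  ext1 p q
  rw [Matrix.map_apply, MvPolynomial.homogeneousComponent_of_mem (wordMat_isHomogeneous w p q),
    if_pos rfl]

theorem length_sum_pos {L : List (List (Fin m))} (hL : ∀ u ∈ L, u ≠ []) (h : L ≠ []) :
    0 < (L.map List.length).sum := by
  obtain ⟨u, L, rfl⟩ := List.exists_cons_of_ne_nil h
  have := List.length_pos_iff.2 (hL u (by simp))
  simp only [List.map_cons, List.sum_cons]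
  omega

variable (K k m) in
/-- The algebra of pure trace polynomials, as a subalgebra of the polynomial ring. -/
def traceAlg : Subalgebra K (MvPolynomial (Fin m × Fin k × Fin k) K) :=
  Algebra.adjoin K {f | ∃ u : List (Fin m), u ≠ [] ∧ f = (wordMat K k m u).trace}

theorem trace_wordMat_mem_traceAlg (u : List (Fin m)) :
    (wordMat K k m u).trace ∈ traceAlg K k m := by
  by_cases hu : u = []
  · subst hu
    rw [wordMat_nil, Matrix.trace_one]
    exact natCast_mem _ _
  · exact Algebra.subset_adjoin ⟨u, hu, rfl⟩

theorem traceProd_mem {S : Subalgebra K (MvPolynomial (Fin m × Fin k × Fin k) K)}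
    {L : List (List (Fin m))} (h : ∀ u ∈ L, (wordMat K k m u).trace ∈ S) :
    traceProd K k m L ∈ S := by
  refine list_prod_mem fun f hf => ?_
  obtain ⟨u, hu, rfl⟩ := List.mem_map.1 hf
  exact h u hu

theorem traceAlg_fg [CharZero K] (hk : 1 ≤ k) : (traceAlg K k m).FG := by
  obtain ⟨N, hN⟩ := exists_wordMat_mem_traceSpan (K := K) (m := m) hk
  set s : Set (MvPolynomial (Fin m × Fin k × Fin k) K) :=
    (fun u => (wordMat K k m u).trace) '' {u : List (Fin m) | u.length ≤ N} with hs
  have hfin : s.Finite := (List.finite_length_le (Fin m) N).image _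
  rw [Subalgebra.fg_def]
  refine ⟨s, hfin, le_antisymm (Algebra.adjoin_le ?_) (Algebra.adjoin_le ?_)⟩
  · rintro _ ⟨u, -, rfl⟩
    exact trace_wordMat_mem_traceAlg u
  · have key : ∀ n, ∀ u : List (Fin m), u.length = n →
        (wordMat K k m u).trace ∈ Algebra.adjoin K s := by
      intro n
      induction n using Nat.strong_induction_on with
      | _ n ih =>
        intro u hu
        by_cases hle : u.length ≤ N
        · exact Algebra.subset_adjoin ⟨u, hle, rfl⟩
        rcases u with _ | ⟨i, v⟩
        · simp at hle
        rw [List.length_cons] at hle hu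
        have hv := wordMat_mem_traceSpan_length (hN v (by omega))
        rw [wordMat_cons]
        generalize wordMat K k m v = x at hv
        induction hv using Submodule.span_induction with
        | mem x hx =>
          obtain ⟨L, w, hL, ⟨hne, hlen⟩, rfl⟩ := hx
          have hpos := length_sum_pos hL hne
          rw [traceMon, mul_smul_comm, Matrix.trace_smul, ← wordMat_cons]
          refine mul_mem (traceProd_mem fun u hu => ih _ ?_ u rfl)
            (ih _ ?_ (i :: w) List.length_cons)
          · have := List.single_le_sum (l := L.map List.length) (by simp) u.length
              (List.mem_map_of_mem hu)
            omega
          · omega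
        | zero => simp
        | add x y _ _ hx hy => rw [mul_add, Matrix.trace_add]; exact add_mem hx hy
        | smul c x _ hx =>
          rw [mul_smul_comm, Matrix.trace_smul]
          exact Subalgebra.smul_mem _ hx c
    rintro _ ⟨u, -, rfl⟩
    exact key _ u rfl

theorem Ckm_eq_map : Ckm K k m = (traceAlg K k m).map
    (IsScalarTower.toAlgHom K (MvPolynomial (Fin m × Fin k × Fin k) K) (Mat K k m)) := by
  rw [traceAlg, AlgHom.map_adjoin, Ckm]
  congr 1
  ext x
  constructor
  · rintro ⟨l, w, rfl⟩
    refine ⟨_, ⟨List.ofFn w, by simp, rfl⟩, ?_⟩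
    rw [wordMat, List.map_ofFn]
    rfl
  · rintro ⟨_, ⟨u, hu, rfl⟩, rfl⟩
    obtain ⟨i, v, rfl⟩ := List.exists_cons_of_ne_nil hu
    refine ⟨v.length, (i :: v).get, ?_⟩
    have : (List.ofFn fun j => genY K k m ((i :: v).get j)) = (i :: v).map (genY K k m) := by
      rw [← Function.comp_def, ← List.map_ofFn, List.ofFn_get]
    erw [this]
    rfl

theorem mem_Ckm {x : Mat K k m} :
    x ∈ Ckm K k m ↔ ∃ f ∈ traceAlg K k m, scalarOf K k m f = x := by
  rw [Ckm_eq_map]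
  exact Iff.rfl

theorem wordMat_mem_Tkm (w : List (Fin m)) : wordMat K k m w ∈ Tkm K k m := by
  refine list_prod_mem fun y hy => ?_
  obtain ⟨i, -, rfl⟩ := List.mem_map.1 hy
  exact (le_sup_left : Rkm K k m ≤ Tkm K k m) (Algebra.subset_adjoin ⟨i, rfl⟩)

theorem mem_traceSpan_of_mem_Tkm {x : Mat K k m} (hx : x ∈ Tkm K k m) :
    x ∈ traceSpan K k m fun _ _ => True := by
  have hone : (1 : Mat K k m) ∈ traceSpan K k m fun _ _ => True := by
    rw [← wordMat_nil, ← traceMon_nil_left]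
    exact traceMon_mem_traceSpan (by simp) trivial
  let S : Subalgebra K (Mat K k m) := (traceSpan K k m fun _ _ => True).toSubalgebra hone
    fun x y hx hy => traceSpan_mul_le (fun _ _ _ _ _ _ => trivial) (Submodule.mul_mem_mul hx hy)
  suffices h : Tkm K k m ≤ S from h hx
  refine sup_le (Algebra.adjoin_le ?_) ?_
  · rintro _ ⟨i, rfl⟩
    have : genY K k m i = traceMon K k m [] [i] := by simp [traceMon_nil_left, wordMat]
    rw [this]
    exact traceMon_mem_traceSpan (by simp) trivial
  · rw [Ckm_eq_map, traceAlg, AlgHom.map_adjoin]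
    refine Algebra.adjoin_le ?_
    rintro _ ⟨_, ⟨u, hu, rfl⟩, rfl⟩
    have : IsScalarTower.toAlgHom K (MvPolynomial (Fin m × Fin k × Fin k) K) (Mat K k m)
        (wordMat K k m u).trace = traceMon K k m [u] [] := by
      simp [traceMon, traceProd_singleton, wordMat_nil, Algebra.algebraMap_eq_smul_one]
    rw [this]
    exact traceMon_mem_traceSpan (by simpa using hu) trivial

theorem trace_mem_traceAlg {x : Mat K k m} (hx : x ∈ Tkm K k m) : x.trace ∈ traceAlg K k m := by
  have h := mem_traceSpan_of_mem_Tkm hx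
  clear hx
  induction h using Submodule.span_induction with
  | mem x hx =>
    obtain ⟨L, w, -, -, rfl⟩ := hx
    rw [trace_traceMon]
    exact mul_mem (traceProd_mem fun u _ => trace_wordMat_mem_traceAlg u)
      (trace_wordMat_mem_traceAlg w)
  | zero => simp
  | add x y _ _ hx hy => rw [Matrix.trace_add]; exact add_mem hx hy
  | smul c x _ hx => rw [Matrix.trace_smul]; exact Subalgebra.smul_mem _ hx c

theorem exists_finset_span_Tkm [CharZero K] (hk : 1 ≤ k) :
    ∃ g : Finset (Mat K k m), ↑g ⊆ (Tkm K k m : Set (Mat K k m)) ∧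
      ∀ x ∈ Tkm K k m, x ∈ Submodule.span (traceAlg K k m) (g : Set (Mat K k m)) := by
  obtain ⟨N, hN⟩ := exists_wordMat_mem_traceSpan (K := K) (m := m) hk
  set s : Set (Mat K k m) := wordMat K k m '' {u : List (Fin m) | u.length ≤ N} with hs
  have hfin : s.Finite := (List.finite_length_le (Fin m) N).image _
  refine ⟨hfin.toFinset, ?_, fun x hx => ?_⟩
  · rw [Set.Finite.coe_toFinset]
    rintro _ ⟨u, -, rfl⟩
    exact wordMat_mem_Tkm u
  rw [Set.Finite.coe_toFinset]
  have hsmul : ∀ (L : List (List (Fin m))) (w : List (Fin m)),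
      wordMat K k m w ∈ Submodule.span (traceAlg K k m) s →
      traceMon K k m L w ∈ Submodule.span (traceAlg K k m) s := fun L w h =>
    Submodule.smul_mem _ (⟨traceProd K k m L,
      traceProd_mem fun u _ => trace_wordMat_mem_traceAlg u⟩ : traceAlg K k m) h
  have hword : ∀ n, ∀ w : List (Fin m), w.length = n →
      wordMat K k m w ∈ Submodule.span (traceAlg K k m) s := by
    intro n
    induction n using Nat.strong_induction_on with
    | _ n ih =>
      intro w hw
      by_cases hle : w.length ≤ N
      · exact Submodule.subset_span ⟨w, hle, rfl⟩
      have hv := wordMat_mem_traceSpan_length (hN w (by omega))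
      refine (Submodule.span_le (p := (Submodule.span (traceAlg K k m) s).restrictScalars K)).2
        ?_ hv
      rintro _ ⟨L, v, hL, ⟨hne, hlen⟩, rfl⟩
      have hpos := length_sum_pos hL hne
      exact hsmul L v (ih _ (by omega) v rfl)
  refine (Submodule.span_le (p := (Submodule.span (traceAlg K k m) s).restrictScalars K)).2
    ?_ (mem_traceSpan_of_mem_Tkm hx)
  rintro _ ⟨L, v, -, -, rfl⟩
  exact hsmul L v (hword _ v rfl)

end TraceMonomials

/-- The permutation matrix of the cycle `q ↦ q + 1`. -/
def cycleMat (K : Type) [Field K] (k : ℕ) [NeZero k] : Matrix (Fin k) (Fin k) K :=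
  Matrix.of fun p q => if p = q + 1 then 1 else 0

open Fin.NatCast in
theorem cycleMat_pow_apply (K : Type) [Field K] (k : ℕ) [NeZero k] (n : ℕ) (p q : Fin k) :
    (cycleMat K k ^ n) p q = if p = q + (n : Fin k) then 1 else 0 := by
  induction n generalizing p q with
  | zero => simp [Matrix.one_apply]
  | succ n ih =>
    rw [pow_succ, Matrix.mul_apply, Finset.sum_eq_single (q + 1)]
    · have h : cycleMat K k (q + 1) q = 1 := by simp [cycleMat]
      rw [ih, h, mul_one, Nat.cast_add_one, add_assoc, add_comm 1]
    · intro b _ hb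
      simp [cycleMat, hb]
    · simp

open Fin.NatCast in
/-- A matrix commuting with two generic matrices is scalar. -/
theorem exists_eq_scalarOf_of_commute {K : Type} [Field K] {k m : ℕ} (hk : 1 ≤ k) {i₀ i₁ : Fin m}
    (hi : i₁ ≠ i₀) {a : Mat K k m} (h₀ : Commute (genY K k m i₀) a)
    (h₁ : Commute (genY K k m i₁) a) : ∃ f, a = scalarOf K k m f := by
  have : NeZero k := ⟨by omega⟩
  let v : Fin k × Fin k → Mat K k m := fun r =>
    genY K k m i₀ ^ (r.1 : ℕ) * genY K k m i₁ * genY K k m i₀ ^ ((-r.2 : Fin k) : ℕ)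
  have hv : ∀ r, Commute (v r) a := fun r => ((h₀.pow_left _).mul_left h₁).mul_left (h₀.pow_left _)
  let W : Matrix (Fin k × Fin k) (Fin k × Fin k) (MvPolynomial (Fin m × Fin k × Fin k) K) :=
    Matrix.of fun r s => v r s.1 s.2
  let e : MvPolynomial (Fin m × Fin k × Fin k) K →+* K := MvPolynomial.eval fun x =>
    if x.1 = i₀ then cycleMat K k x.2.1 x.2.2 else Matrix.single 0 0 1 x.2.1 x.2.2
  have he₀ : e.mapMatrix (genY K k m i₀) = cycleMat K k := by
    ext p q; simp [e, genY]
  have he₁ : e.mapMatrix (genY K k m i₁) = Matrix.single 0 0 1 := by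
    ext p q; simp [e, genY, hi]
  have hW : e.mapMatrix W = 1 := by
    ext r s
    have : e.mapMatrix W r s = (e.mapMatrix (v r)) s.1 s.2 := rfl
    rw [this]
    simp only [v, map_mul, map_pow, he₀, he₁]
    rw [Matrix.mul_apply, Finset.sum_eq_single 0]
    · rw [Matrix.mul_apply, Finset.sum_eq_single 0]
      · simp only [cycleMat_pow_apply, Matrix.single_apply_same, Matrix.one_apply, Prod.ext_iff,
          Fin.cast_val_eq_self, zero_add, mul_one, eq_comm (a := (0 : Fin k)),
          add_neg_eq_zero, eq_comm (a := s.1), eq_comm (a := s.2), mul_ite, mul_zero, ite_and]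
        split_ifs <;> rfl
      · intro b _ hb
        simp [Matrix.single, hb.symm]
      · simp
    · intro b _ hb
      rw [Matrix.mul_apply, Finset.sum_eq_zero, zero_mul]
      intro c _
      simp [Matrix.single, hb.symm]
    · simp
  have hdet : W.det ≠ 0 := by
    intro h
    have h1 : e W.det = 1 := by rw [RingHom.map_det, hW, Matrix.det_one]
    rw [h, map_zero] at h1
    exact zero_ne_one h1
  have hsum : ∀ p q, W.det • Matrix.single p q 1 = ∑ r, W.adjugate (p, q) r • v r := by
    intro p q
    ext1 s t
    have := congrFun (congrFun (Matrix.adjugate_mul W) (p, q)) (s, t)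
    rw [Matrix.mul_apply] at this
    rw [Matrix.sum_apply, Matrix.smul_apply]
    refine Eq.trans ?_ this.symm
    simp [Matrix.single, Matrix.one_apply, Prod.ext_iff]
  have hcomm : ∀ p q, Commute (Matrix.single p q 1) a := by
    intro p q
    have h1 : Commute (W.det • Matrix.single p q 1) a := by
      rw [hsum]
      exact Commute.sum_left _ _ _ fun r _ => (hv r).smul_left _
    refine smul_right_injective _ hdet ?_
    change W.det • (Matrix.single p q 1 * a) = W.det • (a * Matrix.single p q 1)
    rw [← smul_mul_assoc, ← mul_smul_comm]
    exact h1
  obtain ⟨f, hf⟩ := Matrix.mem_range_scalar_of_commute_single (fun p q _ => hcomm p q)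
  exact ⟨f, hf.symm⟩

/-- For `k, m ≥ 2` the pure trace algebra `C_km` coincides with the center of
the mixed trace algebra `T_km`; moreover `C_km` is a finitely generated `K`-algebra and
`T_km` is a finitely generated `C_km`-module. -/
theorem stmt3 (K : Type) [Field K] [CharZero K] (k m : ℕ) (hk : 2 ≤ k) (hm : 2 ≤ m) :
    (Ckm K k m : Set (Mat K k m))
        = {a | a ∈ Tkm K k m ∧ ∀ b ∈ Tkm K k m, a * b = b * a} ∧
    (Ckm K k m).FG ∧
    (∃ g : Finset (Mat K k m), ↑g ⊆ (Tkm K k m : Set (Mat K k m)) ∧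
      ∀ x ∈ Tkm K k m, ∃ c : Mat K k m → Mat K k m,
        (∀ y, c y ∈ Ckm K k m) ∧ x = ∑ y ∈ g, c y * y) := by
  have hk1 : 1 ≤ k := by omega
  have hCT : Ckm K k m ≤ Tkm K k m := le_sup_right
  refine ⟨?_, ?_, ?_⟩
  · ext a
    constructor
    · intro ha
      refine ⟨hCT ha, fun b _ => ?_⟩
      obtain ⟨f, -, rfl⟩ := mem_Ckm.1 ha
      exact Algebra.commutes f b
    · rintro ⟨haT, hcomm⟩
      have hgen : ∀ i, Commute (genY K k m i) a := fun i =>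
        (hcomm _ (by simpa [wordMat] using wordMat_mem_Tkm (K := K) (k := k) [i])).symm
      obtain ⟨f, rfl⟩ := exists_eq_scalarOf_of_commute hk1 (i₀ := ⟨0, by omega⟩)
        (i₁ := ⟨1, by omega⟩) (by simp) (hgen _) (hgen _)
      refine mem_Ckm.2 ⟨f, ?_, rfl⟩
      have htr : (scalarOf K k m f).trace = (k : K) • f := by
        rw [scalarOf, Algebra.algebraMap_eq_smul_one, Matrix.trace_smul, Matrix.trace_one,
          Fintype.card_fin, smul_eq_mul, Algebra.smul_def (k : K), map_natCast, mul_comm]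
      have hk0 : (k : K) ≠ 0 := Nat.cast_ne_zero.2 (by omega)
      rw [← inv_smul_smul₀ hk0 f, ← htr]
      exact Subalgebra.smul_mem _ (trace_mem_traceAlg haT) _
  · rw [Ckm_eq_map]
    exact (traceAlg_fg hk1).map _
  · obtain ⟨g, hg, hspan⟩ := exists_finset_span_Tkm (K := K) (m := m) hk1
    refine ⟨g, hg, fun x hx => ?_⟩
    obtain ⟨c, -, hc⟩ := Submodule.mem_span_finset.1 (hspan x hx)
    refine ⟨fun y => scalarOf K k m (c y), fun y => mem_Ckm.2 ⟨c y, (c y).2, rfl⟩, ?_⟩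
    refine hc.symm.trans (Finset.sum_congr rfl fun y _ => ?_)
    rw [Subalgebra.smul_def, Algebra.smul_def]
    rfl
end
end

section
/- Let k, m ≥ 2. Then GKdim(T_km) = GKdim(C_km) = GKdim(R_km) = k²(m−1) + 1; that is, for A equal to any of T_km, C_km, R_km one has limsup_{n→∞} log_n dim_K(A ∩ M_k(Ω_{≤n})) = k²(m−1) + 1, where Ω_{≤n} ⊆ Ω is the subspace of polynomials of total degree at most n. -/
open scoped BigOperators
noncomputable section

/-- The growth function `n ↦ dim_K (A ∩ M_k(Ω_{≤n}))` of a subalgebra of `M_k(Ω)`. -/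
def growth (K : Type) [Field K] (k m : ℕ) (A : Subalgebra K (Mat K k m)) (n : ℕ) : ℕ :=
  Module.finrank K ↥(Subalgebra.toSubmodule A ⊓ degLE K k m n)

section Slice

open MvPolynomial

variable {K : Type} [Field K] {σ : Type} (H : Set σ) (c : σ → K)

open Classical in
/-- Restriction of polynomials to the affine coordinate slice `x_h = c h`, `h ∈ H`. -/
def sliceHom : MvPolynomial σ K →ₐ[K] MvPolynomial {v // v ∉ H} K :=
  aeval fun v => if hv : v ∈ H then C (c v) else X ⟨v, hv⟩

/-- `VanishOrder H c r p` says that all partial derivatives of `p` of order `< r` in directions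
from `H` vanish on the slice `x_h = c h`, `h ∈ H`. -/
def VanishOrder : ℕ → MvPolynomial σ K → Prop
  | 0, _ => True
  | r + 1, p => sliceHom H c p = 0 ∧ ∀ h ∈ H, VanishOrder r (pderiv h p)

variable {H c}

lemma sliceHom_X_of_mem {v : σ} (hv : v ∈ H) : sliceHom H c (X v) = C (c v) := by
  simp [sliceHom, hv]

lemma sliceHom_X_of_notMem {v : σ} (hv : v ∉ H) : sliceHom H c (X v) = X ⟨v, hv⟩ := by
  simp [sliceHom, hv]

lemma sliceHom_rename (q : MvPolynomial {v // v ∉ H} K) :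
    sliceHom H c (rename Subtype.val q) = q := by
  have : (sliceHom H c).comp (rename Subtype.val) = AlgHom.id K _ := by
    ext v
    simp [sliceHom_X_of_notMem v.2]
  exact DFunLike.congr_fun this q

lemma pderiv_rename_of_mem {h : σ} (hh : h ∈ H) (q : MvPolynomial {v // v ∉ H} K) :
    pderiv h (rename Subtype.val q) = 0 := by
  apply pderiv_eq_zero_of_notMem_vars
  intro hmem
  obtain ⟨v, -, rfl⟩ := mem_vars_rename _ q hmem
  exact v.2 hh

lemma pderiv_sliceHom (v : {v // v ∉ H}) (p : MvPolynomial σ K) :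
    pderiv v (sliceHom H c p) = sliceHom H c (pderiv v.1 p) := by
  induction p using MvPolynomial.induction_on with
  | C a => simp [← algebraMap_eq]
  | add p q hp hq => simp [hp, hq]
  | mul_X p w hp =>
    rw [map_mul, pderiv_mul, hp, pderiv_mul, map_add, map_mul, map_mul]
    congr 2
    by_cases hw : w ∈ H
    · have : w ≠ v.1 := fun h => v.2 (h ▸ hw)
      simp [sliceHom_X_of_mem hw, pderiv_X_of_ne this]
    · rw [sliceHom_X_of_notMem hw]
      by_cases hvw : w = v.1
      · subst hvw; simp
      · rw [pderiv_X_of_ne hvw, pderiv_X_of_ne, map_zero]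
        exact fun h => hvw (congrArg Subtype.val h)

lemma pderiv_pderiv_comm (i j : σ) (p : MvPolynomial σ K) :
    pderiv i (pderiv j p) = pderiv j (pderiv i p) := by
  classical
  have h : ⁅pderiv (R := K) i, pderiv (R := K) j⁆ = 0 := by
    refine derivation_ext fun v => ?_
    simp only [Derivation.commutator_apply, pderiv_X, Derivation.zero_apply]
    by_cases hi : v = i <;> by_cases hj : v = j <;> simp [Pi.single_apply, hi, hj] <;>
      split_ifs <;> simp
  have := DFunLike.congr_fun h p
  rwa [Derivation.commutator_apply, Derivation.zero_apply, sub_eq_zero] at this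

namespace VanishOrder

lemma zero (r : ℕ) : VanishOrder H c r 0 := by
  induction r with
  | zero => trivial
  | succ r ih => exact ⟨map_zero _, fun h _ => by rw [map_zero]; exact ih⟩

lemma add {r : ℕ} {p q : MvPolynomial σ K} (hp : VanishOrder H c r p)
    (hq : VanishOrder H c r q) : VanishOrder H c r (p + q) := by
  induction r generalizing p q with
  | zero => trivial
  | succ r ih =>
    exact ⟨by rw [map_add, hp.1, hq.1, add_zero],
      fun h hh => by rw [map_add]; exact ih (hp.2 h hh) (hq.2 h hh)⟩

lemma of_succ {r : ℕ} {p : MvPolynomial σ K} (hp : VanishOrder H c (r + 1) p) :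
    VanishOrder H c r p := by
  induction r generalizing p with
  | zero => trivial
  | succ r ih => exact ⟨hp.1, fun h hh => ih (hp.2 h hh)⟩

lemma mul_left {r : ℕ} (a : MvPolynomial σ K) {p : MvPolynomial σ K}
    (hp : VanishOrder H c r p) : VanishOrder H c r (a * p) := by
  induction r generalizing a p with
  | zero => trivial
  | succ r ih =>
    refine ⟨by rw [map_mul, hp.1, mul_zero], fun h hh => ?_⟩
    rw [pderiv_mul]
    exact (ih _ hp.of_succ).add (ih _ (hp.2 h hh))

lemma neg {r : ℕ} {p : MvPolynomial σ K} (hp : VanishOrder H c r p) :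
    VanishOrder H c r (-p) := by
  simpa using hp.mul_left (-1)

lemma sum {ι : Type*} {r : ℕ} (s : Finset ι) {f : ι → MvPolynomial σ K}
    (hf : ∀ i ∈ s, VanishOrder H c r (f i)) : VanishOrder H c r (∑ i ∈ s, f i) :=
  Finset.sum_induction f _ (fun _ _ => add) (zero r) hf

lemma mul_of_slice_eq_zero {r : ℕ} {a p : MvPolynomial σ K} (ha : sliceHom H c a = 0)
    (hp : VanishOrder H c r p) : VanishOrder H c (r + 1) (a * p) := by
  induction r generalizing a p with
  | zero => exact ⟨by rw [map_mul, ha, zero_mul], fun _ _ => trivial⟩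
  | succ r ih =>
    refine ⟨by rw [map_mul, ha, zero_mul], fun h hh => ?_⟩
    rw [pderiv_mul]
    exact (hp.mul_left _).add (ih ha (hp.2 h hh))

lemma pderiv_of_notMem {r : ℕ} {v : σ} (hv : v ∉ H) {p : MvPolynomial σ K}
    (hp : VanishOrder H c r p) : VanishOrder H c r (pderiv v p) := by
  induction r generalizing p with
  | zero => trivial
  | succ r ih =>
    refine ⟨?_, fun h hh => ?_⟩
    · rw [← pderiv_sliceHom ⟨v, hv⟩, hp.1, map_zero]
    · rw [show pderiv h (pderiv v p) = pderiv v (pderiv h p) from ?_]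
      · exact ih (hp.2 h hh)
      · exact pderiv_pderiv_comm h v p

lemma of_rename_mul {r : ℕ} {q : MvPolynomial {v // v ∉ H} K} (hq : q ≠ 0)
    {p : MvPolynomial σ K} (hp : VanishOrder H c r (rename Subtype.val q * p)) :
    VanishOrder H c r p := by
  induction r generalizing p with
  | zero => trivial
  | succ r ih =>
    refine ⟨?_, fun h hh => ih ?_⟩
    · have := hp.1
      rw [map_mul, sliceHom_rename] at this
      exact (mul_eq_zero.mp this).resolve_left hq
    · have := hp.2 h hh
      rwa [pderiv_mul, pderiv_rename_of_mem hh, zero_mul, zero_add] at this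

/-- If a polynomial vector field kills `p` up to order `r` and its only relevant transversal
component along the slice is in direction `h₀`, then `∂p/∂x_{h₀}` also vanishes to order `r`. -/
lemma pderiv_of_derivation [Fintype σ] {r : ℕ} {g : σ → MvPolynomial σ K}
    {p : MvPolynomial σ K} (hp : VanishOrder H c r p)
    (hD : VanishOrder H c r (∑ v, g v * pderiv v p)) {h₀ : σ} (hh₀ : h₀ ∈ H)
    (hg₀ : sliceHom H c (g h₀) ≠ 0)
    (hg : ∀ h ∈ H, h ≠ h₀ → sliceHom H c (g h) = 0 ∨ VanishOrder H c r (pderiv h p)) :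
    VanishOrder H c r (pderiv h₀ p) := by
  classical
  cases r with
  | zero => trivial
  | succ r =>
    have hmul : ∀ (a : MvPolynomial σ K) (h : σ), h ∈ H → sliceHom H c a = 0 →
        VanishOrder H c (r + 1) (a * pderiv h p) := fun a h hh ha =>
      mul_of_slice_eq_zero ha (hp.2 h hh)
    rw [← Finset.add_sum_erase _ _ (Finset.mem_univ h₀)] at hD
    have hrest : VanishOrder H c (r + 1)
        (∑ v ∈ Finset.univ.erase h₀, g v * pderiv v p) := by
      refine sum _ fun v hv => ?_
      by_cases hvH : v ∈ H
      · rcases hg v hvH (Finset.ne_of_mem_erase hv) with h | h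
        · exact hmul _ v hvH h
        · exact h.mul_left _
      · exact (hp.pderiv_of_notMem hvH).mul_left _
    have hmain : VanishOrder H c (r + 1) (g h₀ * pderiv h₀ p) := by
      simpa using hD.add hrest.neg
    refine of_rename_mul hg₀ ?_
    have hdiff := hmul (g h₀ - rename Subtype.val (sliceHom H c (g h₀))) h₀ hh₀
      (by rw [map_sub, sliceHom_rename, sub_self])
    have := hmain.add hdiff.neg
    rwa [sub_mul, ← sub_eq_add_neg, sub_sub_cancel] at this

lemma eq_zero [CharZero K] {p : MvPolynomial σ K}
    (hp : ∀ r, VanishOrder H c r p) : p = 0 := by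
  suffices h : ∀ (r : ℕ) (p : MvPolynomial σ K), (∀ d ∈ p.support, d.degree < r) →
      VanishOrder H c r p → p = 0 from
    h (p.totalDegree + 1) p (fun d hd => Nat.lt_succ_of_le (le_totalDegree hd)) (hp _)
  intro r
  induction r with
  | zero =>
    intro p hd _
    exact support_eq_empty.mp (Finset.eq_empty_of_forall_notMem fun d h => by simpa using hd d h)
  | succ r ih =>
    intro p hd hp
    have hder : ∀ h ∈ H, pderiv h p = 0 := by
      intro h hh
      refine ih _ (fun d hmem => ?_) (hp.2 h hh)
      rw [mem_support_iff, coeff_pderiv] at hmem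
      have := hd (d + Finsupp.single h 1) (mem_support_iff.mpr (left_ne_zero_of_mul hmem))
      simpa using this
    have hvars : (p.vars : Set σ) ⊆ Set.range (Subtype.val : {v // v ∉ H} → σ) := by
      intro v hv
      simp only [Subtype.range_coe_subtype, Set.mem_ofPred_eq]
      intro hvH
      obtain ⟨d, hd, hvd⟩ := (mem_vars_iff_mem_support v).mp hv
      have hle : Finsupp.single v 1 ≤ d := by
        simpa [Nat.one_le_iff_ne_zero] using hvd
      have h0 := congrArg (coeff (d - Finsupp.single v 1)) (hder v hvH)
      rw [coeff_pderiv, tsub_add_cancel_of_le hle, coeff_zero] at h0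
      rcases mul_eq_zero.mp h0 with h1 | h1
      · exact mem_support_iff.mp hd h1
      · exact Nat.cast_add_one_ne_zero _ h1
    obtain ⟨q, rfl⟩ := exists_rename_eq_of_vars_subset_range p _ Subtype.val_injective hvars
    have := hp.1
    rw [sliceHom_rename] at this
    rw [this, map_zero]

end VanishOrder

lemma totalDegree_sliceHom_le (p : MvPolynomial σ K) :
    (sliceHom H c p).totalDegree ≤ p.totalDegree := by
  conv_lhs => rw [p.as_sum, map_sum]
  refine (totalDegree_finsetSum _ _).trans (Finset.sup_le fun d hd => ?_)
  rw [monomial_eq, map_mul, ← algebraMap_eq, AlgHom.commutes, algebraMap_eq]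
  refine (totalDegree_mul _ _).trans ?_
  rw [totalDegree_C, zero_add, Finsupp.prod, map_prod]
  refine (totalDegree_finsetProd _ _).trans ((Finset.sum_le_sum fun v _ => ?_).trans
    (le_totalDegree hd))
  rw [map_pow]
  refine (totalDegree_pow _ _).trans ?_
  have : (sliceHom H c (X v)).totalDegree ≤ 1 := by
    by_cases hv : v ∈ H
    · simp [sliceHom_X_of_mem hv]
    · simp [sliceHom_X_of_notMem hv]
  simpa using Nat.mul_le_mul_left (d v) this

end Slice
section UpperBound

open MvPolynomial

variable {K : Type} [Field K] {k m : ℕ}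

/-- The derivation of `Ω` with `y_i ↦ [A, y_i]` on the generic matrices. -/
def conjDerivation (A : Mat K k m) :
    Derivation K (MvPolynomial (Fin m × Fin k × Fin k) K)
      (MvPolynomial (Fin m × Fin k × Fin k) K) :=
  mkDerivation K fun v => (A * genY K k m v.1 - genY K k m v.1 * A) v.2.1 v.2.2

lemma conjDerivation_eq_sum (A : Mat K k m) (p : MvPolynomial (Fin m × Fin k × Fin k) K) :
    conjDerivation A p =
      ∑ v, (A * genY K k m v.1 - genY K k m v.1 * A) v.2.1 v.2.2 * pderiv v p := by
  have h : conjDerivation A =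
      ∑ v, ((A * genY K k m v.1 - genY K k m v.1 * A) v.2.1 v.2.2) •
        (pderiv v : Derivation K (MvPolynomial (Fin m × Fin k × Fin k) K)
          (MvPolynomial (Fin m × Fin k × Fin k) K)) := by
    refine derivation_ext fun w => ?_
    rw [conjDerivation, mkDerivation_X, ← Derivation.coeFnAddMonoidHom_apply (R := K), map_sum,
      Finset.sum_apply, Finset.sum_eq_single w]
    · simp
    · intro v _ hv
      simp [pderiv_X_of_ne (Ne.symm hv)]
    · simp
  rw [h, ← Derivation.coeFnAddMonoidHom_apply (R := K), map_sum, Finset.sum_apply]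
  simp

/-- The subalgebra of matrices on which `conjDerivation A` acts as the commutator with `A`. -/
def infEquivariant (A : Mat K k m) : Subalgebra K (Mat K k m) where
  carrier := {M | M.map (conjDerivation A) = A * M - M * A}
  mul_mem' := by
    intro M N hM hN
    have h : (M * N).map (conjDerivation A) =
        M.map (conjDerivation A) * N + M * N.map (conjDerivation A) := by
      ext p q : 1
      simp only [Matrix.map_apply, Matrix.mul_apply, Matrix.add_apply, map_sum,
        Derivation.leibniz, smul_eq_mul, ← Finset.sum_add_distrib]
      exact Finset.sum_congr rfl fun j _ => by ring
    rw [Set.mem_ofPred_eq] at *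
    rw [h, hM, hN]
    noncomm_ring
  add_mem' := by
    intro M N hM hN
    rw [Set.mem_ofPred_eq] at *
    rw [Matrix.map_add _ (map_add _), hM, hN]
    noncomm_ring
  algebraMap_mem' := by
    intro r
    rw [Set.mem_ofPred_eq, ← Algebra.commutes r A, sub_self]
    ext p q : 1
    rw [Matrix.map_apply, Matrix.algebraMap_matrix_apply]
    split_ifs <;> simp

lemma genY_mem_infEquivariant (A : Mat K k m) (i : Fin m) :
    genY K k m i ∈ infEquivariant A := by
  change (genY K k m i).map _ = _
  ext p q : 1
  simp [conjDerivation, genY]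

lemma scalarOf_mul_comm (f : MvPolynomial (Fin m × Fin k × Fin k) K) (A : Mat K k m) :
    A * scalarOf K k m f = scalarOf K k m f * A := (Algebra.commutes f A).symm

lemma scalarOf_trace_mem_infEquivariant {A M : Mat K k m} (hM : M ∈ infEquivariant A) :
    scalarOf K k m M.trace ∈ infEquivariant A := by
  change (scalarOf K k m M.trace).map _ = _
  have h : conjDerivation A M.trace = 0 := by
    have h1 : conjDerivation A M.trace = (M.map (conjDerivation A)).trace := by
      simp [Matrix.trace, map_sum]
    rw [h1, show M.map (conjDerivation A) = A * M - M * A from hM, Matrix.trace_sub,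
      Matrix.trace_mul_comm, sub_self]
  rw [scalarOf_mul_comm, sub_self]
  ext p q : 1
  rw [Matrix.map_apply, scalarOf, Matrix.algebraMap_matrix_apply]
  split_ifs <;> simp [h]

lemma Tkm_le_infEquivariant (A : Mat K k m) : Tkm K k m ≤ infEquivariant A := by
  refine sup_le (Algebra.adjoin_le ?_) (Algebra.adjoin_le ?_)
  · rintro _ ⟨i, rfl⟩
    exact genY_mem_infEquivariant A i
  · rintro _ ⟨l, w, rfl⟩
    refine scalarOf_trace_mem_infEquivariant (list_prod_mem fun x hx => ?_)
    obtain ⟨j, rfl⟩ := (List.mem_ofFn' _ _).mp hx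
    exact genY_mem_infEquivariant A _

/-- Coordinates normalised on the slice: the off-diagonal entries of `y_{i₀}`, set to `0`,
and the entries of row `o` of `y_{i₁}` off the diagonal, set to `1`. -/
def transversal (i₀ i₁ : Fin m) (o : Fin k) : Set (Fin m × Fin k × Fin k) :=
  {v | (v.1 = i₀ ∧ v.2.1 ≠ v.2.2) ∨ (v.1 = i₁ ∧ v.2.1 = o ∧ v.2.2 ≠ o)}

/-- The values of the normalised coordinates on the slice. -/
def sliceValue (K : Type) [Field K] (i₀ : Fin m) (v : Fin m × Fin k × Fin k) : K :=
  if v.1 = i₀ then 0 else 1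

lemma commutator_single_genY (a b : Fin k) (i : Fin m) (p q : Fin k) :
    ((Matrix.single a b 1 : Mat K k m) * genY K k m i
      - genY K k m i * Matrix.single a b 1 : Mat K k m) p q =
      (if p = a then X (i, b, q) else 0) - (if q = b then X (i, p, a) else 0) := by
  rw [Matrix.sub_apply]
  congr 1
  · split_ifs with h
    · subst h; simp [genY]
    · rw [Matrix.single_mul_apply_of_ne _ _ _ _ _ h]
  · split_ifs with h
    · subst h; simp [genY]
    · rw [Matrix.mul_single_apply_of_ne _ _ _ _ _ h]

/-- A mixed trace function that vanishes on the slice is zero. -/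
lemma eq_zero_of_sliceHom_eq_zero [CharZero K] {i₀ i₁ : Fin m} (hi : i₁ ≠ i₀) (o : Fin k)
    {f : Mat K k m} (hf : f ∈ Tkm K k m)
    (h0 : ∀ p q, sliceHom (transversal i₀ i₁ o) (sliceValue K i₀) (f p q) = 0) : f = 0 := by
  set H := transversal i₀ i₁ o with hH
  set c : Fin m × Fin k × Fin k → K := sliceValue K i₀ with hc
  suffices h : ∀ r p q, VanishOrder H c r (f p q) by
    ext p q : 1
    exact VanishOrder.eq_zero fun r => h r p q
  intro r
  induction r with
  | zero => exact fun _ _ => trivial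
  | succ r ih =>
    intro p q
    have hD : ∀ A : Mat K k m, VanishOrder H c r
        (∑ v, (A * genY K k m v.1 - genY K k m v.1 * A) v.2.1 v.2.2 * pderiv v (f p q)) := by
      intro A
      rw [← conjDerivation_eq_sum]
      have hA : f.map (conjDerivation A) = A * f - f * A := Tkm_le_infEquivariant A hf
      rw [← Matrix.map_apply (f := conjDerivation A), hA, Matrix.sub_apply, Matrix.mul_apply,
        Matrix.mul_apply, sub_eq_add_neg]
      refine (VanishOrder.sum _ fun j _ => (ih _ _).mul_left _).add
        (VanishOrder.sum _ fun j _ => ?_).neg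
      rw [mul_comm]
      exact (ih _ _).mul_left _
    have hcoff : ∀ {a b : Fin k}, a ≠ b → (i₀, a, b) ∈ H := fun hab => Or.inl ⟨rfl, hab⟩
    have hcrow : ∀ {b : Fin k}, b ≠ o → (i₁, o, b) ∈ H := fun hb => Or.inr ⟨rfl, rfl, hb⟩
    have hoff : ∀ {a b : Fin k}, a ≠ b → sliceHom H c (X (i₀, a, b)) = 0 := by
      intro a b hab
      rw [sliceHom_X_of_mem (hcoff hab)]
      simp [hc, sliceValue]
    have hrow : ∀ j, j ≠ o → VanishOrder H c r (pderiv (i₁, o, j) (f p q)) := by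
      intro j hj
      refine (ih p q).pderiv_of_derivation (hD (Matrix.single j j 1))
        (Or.inr ⟨rfl, rfl, hj⟩) ?_ ?_
      · rw [commutator_single_genY, if_neg hj.symm, if_pos rfl, zero_sub, map_neg,
          sliceHom_X_of_mem (hcrow hj)]
        simp [hc, sliceValue, hi]
      · rintro ⟨i, a, b⟩ (⟨rfl : i = i₀, hab : a ≠ b⟩ | ⟨rfl : i = i₁, rfl : a = o, hb : b ≠ a⟩) hne
        · left
          rw [commutator_single_genY]
          by_cases ha : a = j
          · subst ha
            rw [if_pos rfl, if_neg (Ne.symm hab), sub_zero, hoff hab]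
          · by_cases hb : b = j
            · subst hb
              rw [if_neg ha, if_pos rfl, zero_sub, map_neg, hoff hab, neg_zero]
            · rw [if_neg ha, if_neg hb, sub_zero, map_zero]
        · left
          have hbj : b ≠ j := fun h => hne (by rw [h])
          rw [commutator_single_genY, if_neg hj.symm, if_neg hbj, sub_zero, map_zero]
    have hdiag : ∀ a b, a ≠ b → VanishOrder H c r (pderiv (i₀, a, b) (f p q)) := by
      intro a b hab
      refine (ih p q).pderiv_of_derivation (hD (Matrix.single a b 1))
        (Or.inl ⟨rfl, hab⟩) ?_ ?_
      · have hmem : ∀ j : Fin k, (i₀, j, j) ∉ H := by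
          rintro j (⟨-, h⟩ | ⟨h, -⟩)
          · exact h rfl
          · exact hi h.symm
        rw [commutator_single_genY, if_pos rfl, if_pos rfl, map_sub,
          sliceHom_X_of_notMem (hmem b), sliceHom_X_of_notMem (hmem a), sub_ne_zero]
        intro h
        have := X_injective h
        simp only [Subtype.mk.injEq, Prod.mk.injEq] at this
        exact hab this.2.1.symm
      · rintro ⟨i, a', b'⟩
          (⟨rfl : i = i₀, hab' : a' ≠ b'⟩ | ⟨rfl : i = i₁, rfl : a' = o, hb : b' ≠ a'⟩) hne
        · left
          rw [commutator_single_genY]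
          by_cases ha : a' = a
          · have hb : b' ≠ b := fun h => hne (by rw [ha, h])
            rw [if_pos ha, if_neg hb, sub_zero, hoff hb.symm]
          · by_cases hb : b' = b
            · rw [if_neg ha, if_pos hb, zero_sub, map_neg, hoff ha, neg_zero]
            · rw [if_neg ha, if_neg hb, sub_zero, map_zero]
        · exact Or.inr (hrow b' hb)
    refine ⟨h0 p q, ?_⟩
    rintro ⟨i, a, b⟩ (⟨rfl : i = i₀, hab : a ≠ b⟩ | ⟨rfl : i = i₁, rfl : a = o, hb : b ≠ a⟩)
    · exact hdiag a b hab
    · exact hrow b hb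

lemma card_compl_transversal (hk : 1 ≤ k) {i₀ i₁ : Fin m} (hi : i₁ ≠ i₀) (o : Fin k) :
    Nat.card {v // v ∉ transversal i₀ i₁ o} = k ^ 2 * (m - 1) + 1 := by
  have hH : transversal i₀ i₁ o =
      (fun x : Fin k × Fin k => (i₀, x)) '' ((Finset.univ.offDiag : Finset (Fin k × Fin k)) : Set _)
        ∪ (fun j : Fin k => (i₁, o, j)) '' ({o}ᶜ : Set (Fin k)) := by
    ext ⟨i, a, b⟩
    simp only [transversal, Set.mem_ofPred_eq, Set.mem_union, Set.mem_image, Prod.mk.injEq,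
      Finset.mem_coe, Finset.mem_offDiag, Finset.mem_univ, true_and, Set.mem_compl_iff,
      Set.mem_singleton_iff, Prod.exists]
    constructor
    · rintro (⟨rfl, h⟩ | ⟨rfl, rfl, h⟩)
      · exact Or.inl ⟨a, b, h, rfl, rfl, rfl⟩
      · exact Or.inr ⟨b, h, rfl, rfl, rfl⟩
    · rintro (⟨a, b, h, rfl, rfl, rfl⟩ | ⟨b, h, rfl, rfl, rfl⟩)
      · exact Or.inl ⟨rfl, h⟩
      · exact Or.inr ⟨rfl, rfl, h⟩
  have hcard : (transversal i₀ i₁ o).ncard = (k * k - k) + (k - 1) := by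
    rw [hH, Set.ncard_union_eq, Set.ncard_image_of_injective _ (Prod.mk_right_injective i₀),
      Set.ncard_image_of_injective, Set.ncard_coe_finset, Finset.offDiag_card, Set.ncard_compl]
    · simp
    · intro a b h
      simpa using h
    · rw [Set.disjoint_left]
      rintro _ ⟨x, -, rfl⟩ ⟨j, -, h⟩
      exact hi (congrArg Prod.fst h)
  have h := Set.ncard_add_ncard_compl (transversal i₀ i₁ o)
  rw [hcard] at h
  change (transversal i₀ i₁ o)ᶜ.ncard = _
  obtain ⟨n, rfl⟩ : ∃ n, m = n + 1 := ⟨m - 1, (Nat.succ_pred_eq_of_pos i₀.pos).symm⟩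
  simp only [Nat.card_eq_fintype_card, Fintype.card_prod, Fintype.card_fin] at h
  have h2 : k ≤ k * k := Nat.le_mul_self k
  have h3 : (n + 1) * (k * k) = k ^ 2 * n + k * k := by ring
  rw [Nat.add_sub_cancel]
  omega

variable (K) in
/-- The coefficients of a polynomial at the monomials with all exponents at most `n`. -/
def boxCoeff (τ : Type) [Finite τ] (n : ℕ) :
    MvPolynomial τ K →ₗ[K] ((τ → Fin (n + 1)) → K) :=
  LinearMap.pi fun e => lcoeff K (Finsupp.equivFunOnFinite.symm fun v => (e v : ℕ))

lemma eq_zero_of_boxCoeff_eq_zero {τ : Type} [Finite τ] {n : ℕ} {p : MvPolynomial τ K}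
    (hp : p.totalDegree ≤ n) (h : boxCoeff K τ n p = 0) : p = 0 := by
  ext d
  rw [coeff_zero]
  by_contra hd
  have hle : ∀ v, d v < n + 1 := fun v => Nat.lt_succ_of_le <|
    (Finsupp.le_degree v d).trans <| (le_totalDegree (mem_support_iff.mpr hd)).trans hp
  have : boxCoeff K τ n p (fun v => ⟨d v, hle v⟩) = 0 := congrFun h _
  apply hd
  convert this using 1
  simp only [boxCoeff, LinearMap.pi_apply, lcoeff_apply]
  congr 1
  ext v
  simp

/-- A space of matrices that is determined by polynomials of degree at most `n` has at most the
dimension of the space of those polynomials' coefficients. -/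
lemma injective_pi_boxCoeff {τ : Type} [Finite τ] {n : ℕ} {V : Submodule K (Mat K k m)}
    (φ : MvPolynomial (Fin m × Fin k × Fin k) K →ₐ[K] MvPolynomial τ K)
    (hdeg : ∀ f ∈ V, ∀ p q, (φ (f p q)).totalDegree ≤ n)
    (hinj : ∀ f ∈ V, (∀ p q, φ (f p q) = 0) → f = 0) :
    Function.Injective
      ((LinearMap.pi fun p => LinearMap.pi fun q => boxCoeff K τ n ∘ₗ φ.toLinearMap ∘ₗ
        Matrix.entryLinearMap K _ p q) ∘ₗ V.subtype :
        V →ₗ[K] (Fin k → Fin k → (τ → Fin (n + 1)) → K)) := by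
  rw [← LinearMap.ker_eq_bot, LinearMap.ker_eq_bot']
  rintro ⟨f, hf⟩ h
  rw [Submodule.mk_eq_zero]
  refine hinj f hf fun p q => eq_zero_of_boxCoeff_eq_zero (hdeg f hf p q) ?_
  exact congrFun (congrFun h p) q

instance finite_degLE (n : ℕ) : Module.Finite K (degLE K k m n) :=
  Module.Finite.of_injective _ (injective_pi_boxCoeff (V := degLE K k m n) (n := n)
    (AlgHom.id K _) (fun _ hf p q => hf p q) fun f _ h => by ext p q : 1; exact h p q)

lemma growth_Tkm_le [CharZero K] (hk : 1 ≤ k) {i₀ i₁ : Fin m} (hi : i₁ ≠ i₀) (n : ℕ) :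
    growth K k m (Tkm K k m) n ≤ k ^ 2 * (n + 1) ^ (k ^ 2 * (m - 1) + 1) := by
  classical
  rw [← card_compl_transversal hk hi ⟨0, hk⟩]
  refine (LinearMap.finrank_le_finrank_of_injective (injective_pi_boxCoeff (n := n)
    (V := Subalgebra.toSubmodule (Tkm K k m) ⊓ degLE K k m n)
    (sliceHom (transversal i₀ i₁ ⟨0, hk⟩) (sliceValue K i₀))
    (fun f hf p q => (totalDegree_sliceHom_le _).trans (hf.2 p q))
    fun f hf h => eq_zero_of_sliceHom_eq_zero hi _ hf.1 h)).trans (le_of_eq ?_)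
  simp only [Module.finrank_pi_fintype, Module.finrank_self, Finset.sum_const, Finset.card_univ,
    Fintype.card_fin, Fintype.card_fun, Nat.card_eq_fintype_card, smul_eq_mul, mul_one]
  ring

end UpperBound
section Words

open MvPolynomial

variable {K : Type} [Field K] {k m : ℕ}

/-- Entries of a product of matrices interlaced with diagonal matrices, as a sum over walks. -/
lemma diagonal_mul_prod_apply {S ι : Type*} [CommRing S] [Fintype ι] [DecidableEq ι] {l : ℕ}
    (d : Fin (l + 1) → ι → S) (A : Fin l → Matrix ι ι S) (p q : ι) :
    (Matrix.diagonal (d 0) *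
      (List.ofFn fun r => A r * Matrix.diagonal (d r.succ)).prod : Matrix ι ι S) p q =
      ∑ b : Fin (l + 1) → ι, if b 0 = p ∧ b (Fin.last l) = q then
        (∏ r, d r (b r)) * ∏ r, A r (b r.castSucc) (b r.succ) else 0 := by
  induction l generalizing p with
  | zero =>
    rw [← (Equiv.funUnique (Fin 1) ι).symm.sum_comp]
    simp only [List.ofFn_zero, List.prod_nil, mul_one, Matrix.diagonal_apply]
    rw [Finset.sum_eq_single p]
    · simp
    · intro b _ hb
      simp [hb]
    · simp
  | succ l ih =>
    rw [List.ofFn_succ, List.prod_cons, mul_assoc (A 0), Matrix.diagonal_mul, Matrix.mul_apply,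
      ← (Fin.consEquiv fun _ => ι).sum_comp, Fintype.sum_prod_type]
    conv_rhs => rw [Finset.sum_eq_single_of_mem p (Finset.mem_univ p) fun x _ hx =>
      Finset.sum_eq_zero fun b _ => if_neg fun h => hx h.1]
    · simp only [Fin.consEquiv_apply, Fin.cons_zero, true_and, ← Fin.succ_last, Fin.cons_succ,
        Fin.prod_univ_succ (n := l + 1), Fin.prod_univ_succ (n := l), Fin.castSucc_zero,
        Fin.castSucc_succ, Finset.mul_sum]
      have := fun j => ih (fun r => d r.succ) (fun r => A r.succ) j
      simp only [this, Finset.mul_sum]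
      rw [Finset.sum_comm]
      refine Finset.sum_congr rfl fun b _ => ?_
      rw [Finset.sum_eq_single (b 0)]
      · simp only [true_and]
        split_ifs
        · simp only [Fin.prod_univ_succ (n := l)]
          ring
        · simp
      · intro j _ hj
        rw [if_neg (fun h => hj h.1.symm)]
        simp
      · simp

lemma trace_diagonal_mul_prod {S ι : Type*} [CommRing S] [Fintype ι] [DecidableEq ι] {l : ℕ}
    (d : Fin (l + 1) → ι → S) (A : Fin l → Matrix ι ι S) :
    Matrix.trace (Matrix.diagonal (d 0) *
      (List.ofFn fun r => A r * Matrix.diagonal (d r.succ)).prod) =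
      ∑ b : Fin (l + 1) → ι, if b 0 = b (Fin.last l) then
        (∏ r, d r (b r)) * ∏ r, A r (b r.castSucc) (b r.succ) else 0 := by
  simp only [Matrix.trace, Matrix.diag_apply, diagonal_mul_prod_apply]
  rw [Finset.sum_comm]
  refine Finset.sum_congr rfl fun b _ => ?_
  rw [Finset.sum_eq_single (b 0)]
  · simp [eq_comm]
  · intro j _ hj
    rw [if_neg (fun h => hj h.1.symm)]
  · simp

/-- The word `y_{i₀}^{e₀} y_{w₀} y_{i₀}^{e₁} y_{w₁} ⋯ y_{i₀}^{e_l}`. -/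
def wordElt (K : Type) [Field K] {k m l : ℕ} (i₀ : Fin m) (w : Fin l → Fin m)
    (e : Fin (l + 1) →₀ ℕ) : Mat K k m :=
  genY K k m i₀ ^ e 0 *
    (List.ofFn fun r => genY K k m (w r) * genY K k m i₀ ^ e r.succ).prod

/-- The linear map sending the monomial `u^e` to the word with exponents `e`. -/
def wordPoly (K : Type) [Field K] {k m l : ℕ} (i₀ : Fin m) (w : Fin l → Fin m) :
    MvPolynomial (Fin (l + 1)) K →ₗ[K] Mat K k m :=
  (basisMonomials (Fin (l + 1)) K).constr K (wordElt K i₀ w)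

lemma wordPoly_monomial {l : ℕ} (i₀ : Fin m) (w : Fin l → Fin m) (e : Fin (l + 1) →₀ ℕ) :
    wordPoly K i₀ w (monomial e 1) = (wordElt K i₀ w e : Mat K k m) := by
  rw [wordPoly, ← Module.Basis.constr_basis (basisMonomials (Fin (l + 1)) K) K (wordElt K i₀ w) e,
    coe_basisMonomials]

lemma wordPoly_eq_sum {l : ℕ} (i₀ : Fin m) (w : Fin l → Fin m)
    (p : MvPolynomial (Fin (l + 1)) K) :
    wordPoly K i₀ w p = ∑ e ∈ p.support, coeff e p • (wordElt K i₀ w e : Mat K k m) := by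
  conv_lhs => rw [p.as_sum, map_sum]
  refine Finset.sum_congr rfl fun e _ => ?_
  rw [← wordPoly_monomial, ← map_smul, smul_monomial, smul_eq_mul, mul_one]

lemma genY_mem_Rkm (i : Fin m) : genY K k m i ∈ Rkm K k m :=
  Algebra.subset_adjoin ⟨i, rfl⟩

lemma wordPoly_mem_Rkm {l : ℕ} (i₀ : Fin m) (w : Fin l → Fin m)
    (p : MvPolynomial (Fin (l + 1)) K) : wordPoly K i₀ w p ∈ Rkm K k m := by
  rw [wordPoly_eq_sum]
  refine sum_mem fun e _ => Subalgebra.smul_mem _ (mul_mem (pow_mem (genY_mem_Rkm _) _)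
    (list_prod_mem fun x hx => ?_)) _
  obtain ⟨r, rfl⟩ := (List.mem_ofFn' _ _).mp hx
  exact mul_mem (genY_mem_Rkm _) (pow_mem (genY_mem_Rkm _) _)

lemma degLE_mono {n n' : ℕ} (h : n ≤ n') : degLE K k m n ≤ degLE K k m n' :=
  fun _ ha p q => (ha p q).trans h

lemma mul_mem_degLE {n n' : ℕ} {a b : Mat K k m} (ha : a ∈ degLE K k m n)
    (hb : b ∈ degLE K k m n') : a * b ∈ degLE K k m (n + n') := by
  intro p q
  rw [Matrix.mul_apply]
  exact (totalDegree_finsetSum _ _).trans (Finset.sup_le fun j _ =>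
    (totalDegree_mul _ _).trans (add_le_add (ha p j) (hb j q)))

lemma one_mem_degLE : (1 : Mat K k m) ∈ degLE K k m 0 := by
  intro p q
  rw [Matrix.one_apply]
  split_ifs <;> simp

lemma genY_mem_degLE (i : Fin m) : genY K k m i ∈ degLE K k m 1 := by
  intro p q
  simp [genY]

lemma pow_mem_degLE {n : ℕ} {a : Mat K k m} (ha : a ∈ degLE K k m n) (e : ℕ) :
    a ^ e ∈ degLE K k m (e * n) := by
  induction e with
  | zero => simpa using one_mem_degLE
  | succ e ih =>
    rw [pow_succ, add_mul, one_mul]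
    exact mul_mem_degLE ih ha

lemma prod_ofFn_mem_degLE {l : ℕ} {n : Fin l → ℕ} {a : Fin l → Mat K k m}
    (ha : ∀ r, a r ∈ degLE K k m (n r)) :
    (List.ofFn a).prod ∈ degLE K k m (∑ r, n r) := by
  induction l with
  | zero => simpa using one_mem_degLE
  | succ l ih =>
    rw [List.ofFn_succ, List.prod_cons, Fin.sum_univ_succ]
    exact mul_mem_degLE (ha 0) (ih fun r => ha r.succ)

lemma wordElt_mem_degLE {l : ℕ} (i₀ : Fin m) (w : Fin l → Fin m) (e : Fin (l + 1) →₀ ℕ) :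
    (wordElt K i₀ w e : Mat K k m) ∈ degLE K k m (e.degree + l) := by
  have h := mul_mem_degLE (pow_mem_degLE (genY_mem_degLE (K := K) (k := k) i₀) (e 0))
    (prod_ofFn_mem_degLE fun r : Fin l => mul_mem_degLE (genY_mem_degLE (w r))
      (pow_mem_degLE (genY_mem_degLE (K := K) (k := k) i₀) (e r.succ)))
  refine degLE_mono (le_of_eq ?_) h
  rw [Finsupp.degree_eq_sum, Fin.sum_univ_succ, Finset.sum_add_distrib]
  simp
  ring

lemma wordPoly_mem_degLE {l : ℕ} (i₀ : Fin m) (w : Fin l → Fin m)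
    (p : MvPolynomial (Fin (l + 1)) K) :
    (wordPoly K i₀ w p : Mat K k m) ∈ degLE K k m (p.totalDegree + l) := by
  rw [wordPoly_eq_sum]
  exact sum_mem fun e he => Submodule.smul_mem _ _ <| degLE_mono
    (Nat.add_le_add_right (le_totalDegree he) l) (wordElt_mem_degLE i₀ w e)

/-- Specialisation of `y_{i₀}` to a generic diagonal matrix `diag(t_1, …, t_k)`. -/
def diagSpec (K : Type) [Field K] {k m : ℕ} (i₀ : Fin m) :
    MvPolynomial (Fin m × Fin k × Fin k) K →ₐ[K]
      MvPolynomial (Fin m × Fin k × Fin k) (MvPolynomial (Fin k) K) :=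
  aeval fun v => if v.1 = i₀ then (if v.2.1 = v.2.2 then C (X v.2.1) else 0) else X v

lemma diagSpec_trace_wordElt {l : ℕ} {i₀ : Fin m} {w : Fin l → Fin m} (hw : ∀ r, w r ≠ i₀)
    (e : Fin (l + 1) →₀ ℕ) :
    diagSpec K i₀ (wordElt K i₀ w e : Mat K k m).trace =
      ∑ b : Fin (l + 1) → Fin k, if b 0 = b (Fin.last l) then
        monomial (∑ r, Finsupp.single (w r, b r.castSucc, b r.succ) 1)
          (rename b (monomial e (1 : K))) else 0 := by
  have h0 : (diagSpec K i₀).mapMatrix (genY K k m i₀) =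
      Matrix.diagonal fun c => C (X c) := by
    ext p q : 1
    simp [genY, diagSpec, Matrix.diagonal_apply]
  have h1 : ∀ r, (diagSpec K i₀).mapMatrix (genY K k m (w r)) =
      Matrix.of fun p q => X (w r, p, q) := by
    intro r
    ext p q : 1
    simp [genY, diagSpec, hw r]
  have h2 : diagSpec K i₀ (wordElt K i₀ w e : Mat K k m).trace =
      ((diagSpec K i₀).mapMatrix (wordElt K i₀ w e)).trace := by
    simp [Matrix.trace, map_sum]
  rw [h2, wordElt, map_mul, map_pow, map_list_prod, List.map_ofFn, h0, Matrix.diagonal_pow]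
  have h3 : (⇑(diagSpec K i₀).mapMatrix ∘
      fun r => genY K k m (w r) * genY K k m i₀ ^ e r.succ) =
      fun r => (Matrix.of fun p q => X (w r, p, q)) *
        Matrix.diagonal ((fun c => C (X c)) ^ e r.succ) := by
    funext r
    rw [Function.comp_apply, map_mul, map_pow, h0, h1, Matrix.diagonal_pow]
  rw [h3]
  refine (trace_diagonal_mul_prod (S := MvPolynomial (Fin m × Fin k × Fin k) (MvPolynomial (Fin k) K))
    (fun r => (fun c => C (X c)) ^ e r) _).trans ?_
  refine Finset.sum_congr rfl fun b _ => ?_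
  split_ifs
  · rw [monomial_sum_index, monomial_eq, Finsupp.prod_fintype _ _ fun _ => pow_zero _]
    simp only [map_prod, map_pow, rename_X, map_one, one_mul]
    rfl
  · rfl

lemma diagSpec_trace_wordPoly {l : ℕ} {i₀ : Fin m} {w : Fin l → Fin m} (hw : ∀ r, w r ≠ i₀)
    (p : MvPolynomial (Fin (l + 1)) K) :
    diagSpec K i₀ (wordPoly K i₀ w p : Mat K k m).trace =
      ∑ b : Fin (l + 1) → Fin k, if b 0 = b (Fin.last l) then
        monomial (∑ r, Finsupp.single (w r, b r.castSucc, b r.succ) 1) (rename b p) else 0 := by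
  induction p using MvPolynomial.induction_on' with
  | monomial e c =>
    rw [← mul_one c, ← smul_eq_mul, ← smul_monomial, map_smul, wordPoly_monomial,
      Matrix.trace_smul, map_smul, diagSpec_trace_wordElt hw, Finset.smul_sum]
    refine Finset.sum_congr rfl fun b _ => ?_
    rw [smul_ite, smul_zero, map_smul, smul_monomial]
  | add p q hp hq =>
    rw [map_add, Matrix.trace_add, map_add, hp, hq, ← Finset.sum_add_distrib]
    refine Finset.sum_congr rfl fun b _ => ?_
    split_ifs <;> simp

end Words
section Walks

open MvPolynomial

variable {K : Type} [Field K] {k m : ℕ}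

/-- There is a walk with `l` steps from `z` to `o`, with letters different from `i₀`, whose edge
monomial relabelled by any `φ` is `γ φ`, and which visits all vertices in `V`. -/
def HasWalk (i₀ : Fin m) (o z : Fin k) (l : ℕ)
    (γ : (Fin k → Fin k) → Fin m × Fin k × Fin k →₀ ℕ) (V : Set (Fin k)) : Prop :=
  ∃ (w : Fin l → Fin m) (a : Fin (l + 1) → Fin k), (∀ r, w r ≠ i₀) ∧ a 0 = z ∧
    a (Fin.last l) = o ∧
    (∀ φ, ∑ r, Finsupp.single (w r, φ (a r.castSucc), φ (a r.succ)) 1 = γ φ) ∧ V ⊆ Set.range a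

lemma HasWalk.cons {i₀ : Fin m} {o z : Fin k} {l : ℕ}
    {γ : (Fin k → Fin k) → Fin m × Fin k × Fin k →₀ ℕ} {V : Set (Fin k)}
    (h : HasWalk i₀ o z l γ V) {i : Fin m} (hi : i ≠ i₀) (z' : Fin k) :
    HasWalk i₀ o z' (l + 1) (fun φ => Finsupp.single (i, φ z', φ z) 1 + γ φ) (insert z' V) := by
  obtain ⟨w, a, hw, ha0, hal, hγ, hV⟩ := h
  refine ⟨Fin.cons i w, Fin.cons z' a, ?_, rfl, ?_, fun φ => ?_, ?_⟩
  · intro r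
    cases r using Fin.cases with
    | zero => simpa using hi
    | succ r => simpa using hw r
  · rw [← Fin.succ_last, Fin.cons_succ, hal]
  · beta_reduce
    rw [Fin.sum_univ_succ, ← hγ]
    simp [ha0]
  · rw [Fin.range_cons]
    exact Set.insert_subset_insert hV

/-- The edge monomial of the walk `o → a → b → o` using the letters `i₁, i, i₁`, where
`e = (i, a, b)`, with vertices relabelled by `φ`. -/
def loopExp (i₁ : Fin m) (o : Fin k) (φ : Fin k → Fin k) (e : Fin m × Fin k × Fin k) :
    Fin m × Fin k × Fin k →₀ ℕ :=
  Finsupp.single (i₁, φ o, φ e.2.1) 1 + (Finsupp.single (e.1, φ e.2.1, φ e.2.2) 1 +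
    Finsupp.single (i₁, φ e.2.2, φ o) 1)

lemma hasWalk_multiset {i₀ i₁ : Fin m} (hi : i₁ ≠ i₀) (o : Fin k)
    (s : Multiset (Fin m × Fin k × Fin k)) (hs : ∀ e ∈ s, e.1 ≠ i₀) :
    HasWalk i₀ o o (3 * s.card) (fun φ => (s.map (loopExp i₁ o φ)).sum)
      {a | ∃ e ∈ s, e.2.1 = a} := by
  induction s using Multiset.induction with
  | empty => exact ⟨Fin.elim0, fun _ => o, fun r => r.elim0, rfl, rfl, by simp, by simp⟩
  | cons e s ih =>
    obtain ⟨w, a, hw, ha0, hal, hγ, hV⟩ :=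
      (((ih fun e he => hs e (Multiset.mem_cons_of_mem he)).cons hi e.2.2).cons
        (hs e (Multiset.mem_cons_self e s)) e.2.1).cons hi o
    have hl : 3 * (e ::ₘ s).card = 3 * s.card + 1 + 1 + 1 := by
      rw [Multiset.card_cons]; ring
    rw [hl]
    refine ⟨w, a, hw, ha0, hal, fun φ => ?_, ?_⟩
    · refine (hγ φ).trans ?_
      simp only [Multiset.map_cons, Multiset.sum_cons, loopExp, add_assoc]
    · rintro _ ⟨e', he', rfl⟩
      apply hV
      rcases Multiset.mem_cons.mp he' with rfl | h
      · exact Set.mem_insert_of_mem _ (Set.mem_insert _ _)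
      · exact Set.mem_insert_of_mem _ (Set.mem_insert_of_mem _ (Set.mem_insert_of_mem _ ⟨e', h, rfl⟩))

/-- The edge monomial of a walk passing `α e` times through the loop of `e`. -/
def loopSum (i₁ : Fin m) (o : Fin k) (α : Fin m × Fin k × Fin k → ℕ) (φ : Fin k → Fin k) :
    Fin m × Fin k × Fin k →₀ ℕ :=
  ∑ e, α e • loopExp i₁ o φ e

lemma hasWalk_loopSum {i₀ i₁ : Fin m} (hi : i₁ ≠ i₀) (o : Fin k)
    {α : Fin m × Fin k × Fin k → ℕ} (hα : ∀ e, e.1 = i₀ → α e = 0) :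
    HasWalk i₀ o o (3 * ∑ e, α e) (loopSum i₁ o α) {a | ∃ e, α e ≠ 0 ∧ e.2.1 = a} := by
  have hmem : ∀ e, e ∈ ∑ e, α e • ({e} : Multiset (Fin m × Fin k × Fin k)) ↔ α e ≠ 0 := by
    intro e
    simp [Multiset.mem_sum, Multiset.mem_nsmul]
  have h := hasWalk_multiset hi o (∑ e, α e • ({e} : Multiset (Fin m × Fin k × Fin k)))
    fun e he h => (hmem e).mp he (hα e h)
  have hsum : ∀ φ, ((∑ e, α e • ({e} : Multiset (Fin m × Fin k × Fin k))).map
      (loopExp i₁ o φ)).sum = loopSum i₁ o α φ := by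
    intro φ
    rw [← Multiset.coe_mapAddMonoidHom, ← Multiset.coe_sumAddMonoidHom, map_sum, map_sum]
    simp only [map_nsmul, Multiset.coe_mapAddMonoidHom, Multiset.coe_sumAddMonoidHom,
      Multiset.map_singleton, Multiset.sum_singleton, loopSum]
  simpa only [hsum, hmem, Multiset.card_sum, Multiset.card_nsmul, Multiset.card_singleton,
    mul_one] using h

lemma loopSum_apply (i₁ : Fin m) (o : Fin k) (α : Fin m × Fin k × Fin k → ℕ)
    (φ : Fin k → Fin k) (v : Fin m × Fin k × Fin k) :
    loopSum i₁ o α φ v = ∑ e, α e * loopExp i₁ o φ e v := by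
  simp [loopSum]

lemma loopExp_id_self_pos (i₁ : Fin m) (o : Fin k) (v : Fin m × Fin k × Fin k) :
    1 ≤ loopExp i₁ o id v v := by
  simp only [loopExp, id, Finsupp.add_apply, Finsupp.single_eq_same]
  omega

lemma eq_of_loopExp_id_ne_zero {i₁ : Fin m} {o : Fin k} {e v : Fin m × Fin k × Fin k}
    (h : loopExp i₁ o id e v ≠ 0) :
    v = (i₁, o, e.2.1) ∨ v = e ∨ v = (i₁, e.2.2, o) := by
  by_contra! hn
  apply h
  simp [loopExp, Finsupp.single_apply, hn.1.symm, hn.2.2.symm]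
  exact hn.2.1.symm

lemma le_loopSum_id (i₁ : Fin m) (o : Fin k) (α : Fin m × Fin k × Fin k → ℕ)
    (v : Fin m × Fin k × Fin k) : α v ≤ loopSum i₁ o α id v := by
  rw [loopSum_apply]
  refine le_trans ?_ (Finset.single_le_sum (f := fun e => α e * loopExp i₁ o id e v)
    (fun _ _ => Nat.zero_le _) (Finset.mem_univ v))
  exact Nat.le_mul_of_pos_right _ (loopExp_id_self_pos i₁ o v)

lemma loopSum_id_diag (i₁ : Fin m) {o a : Fin k} (ha : a ≠ o)
    (α : Fin m × Fin k × Fin k → ℕ) : loopSum i₁ o α id (i₁, a, a) = α (i₁, a, a) := by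
  rw [loopSum_apply, Finset.sum_eq_single (i₁, a, a)]
  · simp [loopExp, ha]
  · intro e _ he
    rw [mul_eq_zero]
    right
    by_contra h
    rcases eq_of_loopExp_id_ne_zero h with h | h | h
    · simp [ha] at h
    · exact he h.symm
    · simp [ha] at h
  · simp

/-- The exponents of loops along edges outside the star `(i₁, o, b)`, `b ≠ o`, are determined by
the edge monomial of the walk. -/
lemma loopSum_id_injective {i₁ : Fin m} {o : Fin k} {α α' : Fin m × Fin k × Fin k → ℕ}
    (hα : ∀ b, b ≠ o → α (i₁, o, b) = 0) (hα' : ∀ b, b ≠ o → α' (i₁, o, b) = 0)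
    (h : loopSum i₁ o α id = loopSum i₁ o α' id) : α = α' := by
  have key : ∀ v, (∀ e, e ≠ v → loopExp i₁ o id e v ≠ 0 → α e = α' e) → α v = α' v := by
    intro v hv
    have h1 := DFunLike.congr_fun h v
    rw [loopSum_apply, loopSum_apply, ← Finset.add_sum_erase _ _ (Finset.mem_univ v),
      ← Finset.add_sum_erase _ (fun e => α' e * _) (Finset.mem_univ v),
      Finset.sum_congr rfl (g := fun e => α' e * loopExp i₁ o id e v)] at h1
    · exact Nat.eq_of_mul_eq_mul_right (loopExp_id_self_pos i₁ o v) (Nat.add_right_cancel h1)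
    · intro e he
      by_cases h0 : loopExp i₁ o id e v = 0
      · rw [h0, mul_zero, mul_zero]
      · rw [hv e (Finset.ne_of_mem_erase he) h0]
  have h1 : ∀ v : Fin m × Fin k × Fin k, ¬(v.1 = i₁ ∧ (v.2.1 = o ∨ v.2.2 = o)) → α v = α' v := by
    intro v hv
    refine key v fun e he h0 => ?_
    rcases eq_of_loopExp_id_ne_zero h0 with rfl | rfl | rfl
    · simp at hv
    · exact absurd rfl he
    · simp at hv
  have h2 : ∀ v : Fin m × Fin k × Fin k, v.2.2 ≠ o → α v = α' v := by
    rintro ⟨i, a, b⟩ hb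
    by_cases hv : i = i₁ ∧ a = o
    · obtain ⟨rfl, rfl⟩ := hv
      rw [hα b hb, hα' b hb]
    · exact h1 _ fun h => hv ⟨h.1, h.2.resolve_right hb⟩
  have h3 : ∀ v : Fin m × Fin k × Fin k, v ≠ (i₁, o, o) → α v = α' v := by
    rintro ⟨i, a, b⟩ hv
    by_cases hb : b = o
    · subst hb
      by_cases hi : i = i₁
      · subst hi
        have ha : a ≠ b := fun h => hv (by rw [h])
        refine key _ fun e he h0 => h2 e ?_
        rcases eq_of_loopExp_id_ne_zero h0 with h | h | h
        · simp [ha] at h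
        · exact absurd h.symm he
        · simp only [Prod.mk.injEq, true_and, and_true] at h
          rwa [← h]
      · exact h1 _ fun h => hi h.1
    · exact h2 _ hb
  funext v
  by_cases hv : v = (i₁, o, o)
  · exact key v fun e he _ => h3 e (hv ▸ he)
  · exact h3 v hv

lemma loopSum_perm_apply (i₁ : Fin m) (o : Fin k) (α : Fin m × Fin k × Fin k → ℕ)
    (σ : Equiv.Perm (Fin k)) (i : Fin m) (a b : Fin k) :
    loopSum i₁ o α σ (i, σ a, σ b) = loopSum i₁ o α id (i, a, b) := by
  simp only [loopSum_apply, loopExp, Finsupp.add_apply, Finsupp.single_apply, Prod.mk.injEq,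
    EmbeddingLike.apply_eq_iff_eq, id]

/-- If the diagonal loops are traversed a number of times lying in pairwise disjoint ranges, then
the edge monomial determines the labelling of the vertices. -/
lemma perm_eq_one_of_loopSum {i₁ : Fin m} {o : Fin k} (ho : o.val = 0) {N : ℕ}
    {α α' : Fin m × Fin k × Fin k → ℕ}
    (h1 : ∀ a, a ≠ o → α (i₁, a, a) / N = a.val) (h2 : k ≤ α (i₁, o, o) / N)
    (h1' : ∀ a, a ≠ o → α' (i₁, a, a) / N = a.val) (h2' : k ≤ α' (i₁, o, o) / N)
    {σ : Equiv.Perm (Fin k)} (h : loopSum i₁ o α' σ = loopSum i₁ o α id) : σ = 1 := by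
  have key : ∀ α : Fin m × Fin k × Fin k → ℕ, (∀ a, a ≠ o → α (i₁, a, a) / N = a.val) →
      k ≤ α (i₁, o, o) / N → ∀ a, min (loopSum i₁ o α id (i₁, a, a) / N) k =
        if a = o then k else a.val := by
    intro α h1 h2 a
    split_ifs with ha
    · subst ha
      exact min_eq_right (h2.trans (Nat.div_le_div_right (le_loopSum_id _ _ _ _)))
    · rw [loopSum_id_diag _ ha, h1 a ha]
      exact min_eq_left a.isLt.le
  ext a
  have h3 := key α' h1' h2' a
  rw [← loopSum_perm_apply i₁ o α' σ, h, key α h1 h2] at h3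
  have := a.isLt
  have := (σ a).isLt
  simp only [Equiv.Perm.coe_one, id]
  split_ifs at h3 with ha hb hb
  · rw [ha, hb]
  · omega
  · omega
  · exact h3

/-- A polynomial in the positions of a walk that vanishes at all walks except for the relabellings
of the given surjective walk `a`. -/
def patternPoly (K : Type) [Field K] {n : ℕ} {a : Fin n → Fin k} (ha : Function.Surjective a) :
    MvPolynomial (Fin n) K :=
  ∏ r, ∏ c ∈ Finset.univ.erase (a r), (X r - X (Function.surjInv ha c))

lemma totalDegree_patternPoly_le {n : ℕ} {a : Fin n → Fin k} (ha : Function.Surjective a) :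
    (patternPoly K ha).totalDegree ≤ n * k := by
  refine (totalDegree_finsetProd _ _).trans ?_
  refine (Finset.sum_le_card_nsmul _ _ k fun r _ => ?_).trans (by simp)
  refine (totalDegree_finsetProd _ _).trans ?_
  refine (Finset.sum_le_card_nsmul _ _ 1 fun c _ => ?_).trans ?_
  · refine (totalDegree_sub _ _).trans ?_
    simp
  · simp

lemma rename_patternPoly_self_ne_zero {n : ℕ} {a : Fin n → Fin k} (ha : Function.Surjective a) :
    rename a (patternPoly K ha) ≠ 0 := by
  simp only [patternPoly, map_prod, map_sub, rename_X]
  refine Finset.prod_ne_zero_iff.mpr fun r _ => Finset.prod_ne_zero_iff.mpr fun c hc => ?_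
  rw [Function.surjInv_eq ha, sub_ne_zero]
  exact fun h => Finset.ne_of_mem_erase hc (X_injective h).symm

lemma exists_perm_of_rename_patternPoly_ne_zero {n : ℕ} {a b : Fin n → Fin k}
    (ha : Function.Surjective a) (h : rename b (patternPoly K ha) ≠ 0) :
    ∃ σ : Equiv.Perm (Fin k), b = σ ∘ a := by
  simp only [patternPoly, map_prod, map_sub, rename_X] at h
  have hne : ∀ r c, c ≠ a r → b r ≠ b (Function.surjInv ha c) := fun r c hc hb =>
    Finset.prod_ne_zero_iff.mp (Finset.prod_ne_zero_iff.mp h r (Finset.mem_univ r)) c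
      (Finset.mem_erase.mpr ⟨hc, Finset.mem_univ c⟩) (by rw [hb, sub_self])
  have hinj : Function.Injective (b ∘ Function.surjInv ha) := by
    intro c c' hcc
    by_contra hn
    refine hne (Function.surjInv ha c) c' ?_ hcc
    rw [Function.surjInv_eq ha]
    exact Ne.symm hn
  refine ⟨Equiv.ofBijective _ (Finite.injective_iff_bijective.mp hinj), funext fun r => ?_⟩
  obtain ⟨c, hc⟩ := Finite.surjective_of_injective hinj (b r)
  by_cases hca : c = a r
  · rw [← hc, hca]
    rfl
  · exact absurd hc.symm (hne r c hca)

end Walks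
section Independence

open MvPolynomial

variable {K : Type} [Field K] {k m : ℕ}

/-- Multiplicities of loops for which the walk and its labelling are determined by the edge
monomial. -/
structure IsSeparating (i₀ i₁ : Fin m) (o : Fin k) (N : ℕ)
    (α : Fin m × Fin k × Fin k → ℕ) : Prop where
  eq_zero_of_fst : ∀ e, e.1 = i₀ → α e = 0
  eq_zero_of_star : ∀ b, b ≠ o → α (i₁, o, b) = 0
  diag_div : ∀ a, a ≠ o → α (i₁, a, a) / N = a.val
  le_div : k ≤ α (i₁, o, o) / N

lemma IsSeparating.diag_ne_zero {i₀ i₁ : Fin m} {o : Fin k} (ho : o.val = 0) {N : ℕ}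
    {α : Fin m × Fin k × Fin k → ℕ} (hα : IsSeparating i₀ i₁ o N α) (a : Fin k) :
    α (i₁, a, a) ≠ 0 := by
  intro h
  by_cases ha : a = o
  · subst ha
    have := hα.le_div
    rw [h, Nat.zero_div] at this
    have := a.isLt
    omega
  · have := hα.diag_div a ha
    rw [h, Nat.zero_div] at this
    exact ha (Fin.ext (by omega))

/-- For separating multiplicities there are elements of `R_km` whose traces have a prescribed
leading coefficient after specialisation. -/
lemma IsSeparating.exists_elements {i₀ i₁ : Fin m} (hi : i₁ ≠ i₀) {o : Fin k} (ho : o.val = 0)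
    {N : ℕ} {α : Fin m × Fin k × Fin k → ℕ} (hα : IsSeparating i₀ i₁ o N α) :
    ∃ (E : (Fin k →₀ ℕ) → Mat K k m) (P : MvPolynomial (Fin k) K), P ≠ 0 ∧
      (∀ β, E β ∈ Rkm K k m) ∧
      (∀ β, E β ∈ degLE K k m
        ((3 * ∑ e, α e + 1) * k + β.degree + 3 * ∑ e, α e)) ∧
      ∀ α' β, IsSeparating i₀ i₁ o N α' →
        coeff (loopSum i₁ o α' id) (diagSpec K i₀ (E β).trace) =
          if α = α' then P * monomial β 1 else 0 := by
  obtain ⟨w, a, hw, ha0, hal, hγ, hV⟩ := hasWalk_loopSum hi o hα.eq_zero_of_fst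
  have ha : Function.Surjective a := fun c => hV ⟨_, hα.diag_ne_zero ho c, rfl⟩
  refine ⟨fun β => wordPoly K i₀ w
    (patternPoly K ha * rename (Function.surjInv ha) (monomial β 1)),
    rename a (patternPoly K ha), rename_patternPoly_self_ne_zero ha,
    fun β => wordPoly_mem_Rkm _ _ _, fun β => ?_, fun α' β hα' => ?_⟩
  · refine degLE_mono (Nat.add_le_add_right ?_ _) (wordPoly_mem_degLE _ _ _)
    refine (totalDegree_mul _ _).trans (add_le_add (totalDegree_patternPoly_le ha) ?_)
    refine (totalDegree_rename_le _ _).trans ?_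
    rw [totalDegree_monomial _ one_ne_zero]
    exact le_rfl
  · have hself : rename a (patternPoly K ha * rename (Function.surjInv ha) (monomial β 1)) =
        rename a (patternPoly K ha) * monomial β 1 := by
      rw [map_mul, rename_rename, (Function.rightInverse_surjInv ha).comp_eq_id, rename_id_apply]
    have hone : ∀ b : Fin (3 * ∑ e, α e + 1) → Fin k,
        rename b (patternPoly K ha * rename (Function.surjInv ha) (monomial β 1)) ≠ 0 →
        ∑ r, Finsupp.single (w r, b r.castSucc, b r.succ) 1 = loopSum i₁ o α' id →
        b = a ∧ α = α' := by
      intro b hb hsum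
      rw [map_mul] at hb
      obtain ⟨σ, rfl⟩ := exists_perm_of_rename_patternPoly_ne_zero ha (left_ne_zero_of_mul hb)
      have hσ : loopSum i₁ o α σ = loopSum i₁ o α' id := (hγ σ).symm.trans hsum
      obtain rfl := perm_eq_one_of_loopSum ho hα'.diag_div hα'.le_div hα.diag_div hα.le_div hσ
      exact ⟨rfl, loopSum_id_injective hα.eq_zero_of_star hα'.eq_zero_of_star hσ⟩
    rw [diagSpec_trace_wordPoly hw, coeff_sum, Finset.sum_eq_single a]
    · rw [if_pos (ha0.trans hal.symm), coeff_monomial, hself]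
      refine if_congr ⟨fun h => (hone a ?_ h).2, fun h => ?_⟩ rfl rfl
      · rw [hself]
        exact mul_ne_zero (rename_patternPoly_self_ne_zero ha)
          (monomial_eq_zero.not.mpr one_ne_zero)
      · exact h ▸ hγ id
    · intro b _ hb
      split_ifs
      · rw [coeff_monomial, ite_eq_right_iff]
        intro h
        by_contra h0
        exact hb (hone b h0 h).1
      · exact coeff_zero _
    · exact fun h => absurd (Finset.mem_univ a) h

open Classical in
/-- The multiplicities of loops attached to exponents of the coordinates outside the transversal. -/
def loopCount (i₀ i₁ : Fin m) (o : Fin k) {N : ℕ} (δ : {v // v ∉ transversal i₀ i₁ o} → Fin N)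
    (e : Fin m × Fin k × Fin k) : ℕ :=
  if h : e ∉ transversal i₀ i₁ o ∧ e.1 ≠ i₀ then
    (δ ⟨e, h.1⟩ : ℕ) + if e.1 = i₁ ∧ e.2.1 = e.2.2 then
      N * (if e.2.1 = o then k else e.2.1.val) else 0
  else 0

lemma diag_notMem_transversal (i₀ i₁ i : Fin m) (o a : Fin k) :
    (i, a, a) ∉ transversal i₀ i₁ o := by
  rintro (h | h)
  · exact h.2 rfl
  · exact h.2.2 h.2.1

lemma isSeparating_loopCount {i₀ i₁ : Fin m} (hi : i₁ ≠ i₀) (o : Fin k) {N : ℕ}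
    (δ : {v // v ∉ transversal i₀ i₁ o} → Fin N) :
    IsSeparating i₀ i₁ o N (loopCount i₀ i₁ o δ) := by
  have hdiag : ∀ a, loopCount i₀ i₁ o δ (i₁, a, a) / N = if a = o then k else a.val := by
    intro a
    have hd := (δ ⟨(i₁, a, a), diag_notMem_transversal i₀ i₁ i₁ o a⟩).isLt
    rw [loopCount, dif_pos ⟨diag_notMem_transversal i₀ i₁ i₁ o a, hi⟩, if_pos ⟨rfl, rfl⟩,
      Nat.add_mul_div_left _ _ (by omega), Nat.div_eq_of_lt hd, zero_add]
  refine ⟨fun e he => dif_neg fun h => h.2 he, fun b hb => dif_neg fun h => h.1 ?_,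
    fun a ha => by rw [hdiag, if_neg ha], by rw [hdiag, if_pos rfl]⟩
  exact Or.inr ⟨rfl, rfl, hb⟩

lemma loopCount_le (i₀ i₁ : Fin m) (o : Fin k) {N : ℕ}
    (δ : {v // v ∉ transversal i₀ i₁ o} → Fin N) (e : Fin m × Fin k × Fin k) :
    loopCount i₀ i₁ o δ e ≤ N * (k + 1) := by
  rw [loopCount]
  split_ifs with h h1 h2
  · have := (δ ⟨e, h.1⟩).isLt
    linarith
  · have := (δ ⟨e, h.1⟩).isLt
    have := Nat.mul_le_mul_left N e.2.1.isLt.le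
    linarith
  · have := (δ ⟨e, h.1⟩).isLt
    nlinarith
  · exact Nat.zero_le _

/-- The exponents of the diagonal entries of `y_{i₀}`. -/
def diagExp (i₀ i₁ : Fin m) (o : Fin k) {N : ℕ} (δ : {v // v ∉ transversal i₀ i₁ o} → Fin N) :
    Fin k →₀ ℕ :=
  Finsupp.equivFunOnFinite.symm fun a =>
    (δ ⟨(i₀, a, a), diag_notMem_transversal i₀ i₁ i₀ o a⟩ : ℕ)

lemma diagExp_degree_le (i₀ i₁ : Fin m) (o : Fin k) {N : ℕ}
    (δ : {v // v ∉ transversal i₀ i₁ o} → Fin N) : (diagExp i₀ i₁ o δ).degree ≤ k * N := by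
  rw [Finsupp.degree_eq_sum]
  refine (Finset.sum_le_card_nsmul _ _ N fun a _ => ?_).trans (by simp)
  exact (δ ⟨(i₀, a, a), diag_notMem_transversal i₀ i₁ i₀ o a⟩).isLt.le

lemma eq_of_loopCount_of_diagExp {i₀ i₁ : Fin m} {o : Fin k} {N : ℕ}
    {δ δ' : {v // v ∉ transversal i₀ i₁ o} → Fin N}
    (h : loopCount i₀ i₁ o δ = loopCount i₀ i₁ o δ') (h' : diagExp i₀ i₁ o δ = diagExp i₀ i₁ o δ') :
    δ = δ' := by
  funext ⟨⟨i, a, b⟩, hv⟩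
  by_cases hi : i = i₀
  · subst hi
    have hab : a = b := by
      by_contra hab
      exact hv (Or.inl ⟨rfl, hab⟩)
    subst hab
    exact Fin.ext (DFunLike.congr_fun h' a)
  · have := congr_fun h (i, a, b)
    rw [loopCount, loopCount, dif_pos ⟨hv, hi⟩, dif_pos ⟨hv, hi⟩] at this
    exact Fin.ext (Nat.add_right_cancel this)

/-- A family of elements of `R_km`, indexed by a cube of side `N` of dimension the number of
coordinates outside the transversal, with linearly independent traces and degree linear in `N`. -/
lemma exists_linearIndependent_trace {i₀ i₁ : Fin m} (hi : i₁ ≠ i₀) {o : Fin k}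
    (ho : o.val = 0) (N : ℕ) :
    ∃ E : ({v // v ∉ transversal i₀ i₁ o} → Fin N) → Mat K k m,
      (∀ δ, E δ ∈ Rkm K k m) ∧
      (∀ δ, E δ ∈ degLE K k m ((3 * (m * (k * k) * (N * (k + 1))) + 1) * k + k * N +
        3 * (m * (k * k) * (N * (k + 1))))) ∧
      LinearIndependent K fun δ => (E δ).trace := by
  classical
  choose E P hP hR hdeg hcoeff using fun α : Set.range (loopCount i₀ i₁ o (N := N)) =>
    IsSeparating.exists_elements (K := K) hi ho
      (show IsSeparating i₀ i₁ o N α by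
        obtain ⟨_, δ, rfl⟩ := α
        exact isSeparating_loopCount hi o δ)
  refine ⟨fun δ => E ⟨_, δ, rfl⟩ (diagExp i₀ i₁ o δ), fun δ => hR _ _, fun δ => ?_, ?_⟩
  · have hsum : ∑ e, loopCount i₀ i₁ o δ e ≤ m * (k * k) * (N * (k + 1)) :=
      (Finset.sum_le_card_nsmul _ _ _ fun e _ => loopCount_le i₀ i₁ o δ e).trans (by simp)
    refine degLE_mono ?_ (hdeg _ _)
    have := diagExp_degree_le i₀ i₁ o δ
    dsimp only
    gcongr
  · rw [Fintype.linearIndependent_iff]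
    intro c hc δ₀
    have h := congr_arg (fun x => coeff (loopSum i₁ o (loopCount i₀ i₁ o δ₀) id)
      (diagSpec K i₀ x)) hc
    simp only [map_sum, map_smul, coeff_sum, coeff_smul, map_zero, coeff_zero,
      hcoeff _ _ _ (isSeparating_loopCount hi o δ₀)] at h
    have h2 : P ⟨_, δ₀, rfl⟩ * ∑ δ, c δ • (if loopCount i₀ i₁ o δ = loopCount i₀ i₁ o δ₀ then
        monomial (diagExp i₀ i₁ o δ) (1 : K) else 0) = 0 := by
      rw [Finset.mul_sum]
      refine Eq.trans ?_ h
      refine Finset.sum_congr rfl fun δ _ => ?_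
      split_ifs with hδ
      · rw [mul_smul_comm]
        congr 3
        exact Subtype.ext hδ.symm
      · simp
    have h3 := congr_arg (coeff (diagExp i₀ i₁ o δ₀))
      ((mul_eq_zero.mp h2).resolve_left (hP _))
    rw [coeff_sum, Finset.sum_eq_single δ₀] at h3
    · simpa using h3
    · intro δ _ hδ
      split_ifs with hl
      · rw [coeff_smul, coeff_monomial, if_neg fun hd => hδ (eq_of_loopCount_of_diagExp hl hd),
          smul_zero]
      · simp
    · exact fun h => absurd (Finset.mem_univ δ₀) h

end Independence
section Growth

open MvPolynomial

variable {K : Type} [Field K] {k m : ℕ}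

lemma scalarOf_trace_mem_Ckm {r : Mat K k m} (hr : r ∈ Rkm K k m) :
    scalarOf K k m r.trace ∈ Ckm K k m := by
  rw [Rkm, ← Subalgebra.mem_toSubmodule, Algebra.adjoin_eq_span] at hr
  induction hr using Submodule.span_induction with
  | mem x hx =>
    obtain ⟨L, hL, rfl⟩ := Submonoid.exists_list_of_mem_closure hx
    rcases L with _ | ⟨y, L⟩
    · rw [List.prod_nil, Matrix.trace_one, scalarOf, map_natCast]
      exact natCast_mem _ _
    · choose f hf using fun j => hL _ (List.get_mem (y :: L) j)
      refine Algebra.subset_adjoin ⟨L.length, f, ?_⟩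
      congr 3
      conv_lhs => rw [← List.ofFn_get (y :: L)]
      congr 1
      funext j
      exact (hf j).symm
  | zero => simp [scalarOf]
  | add x y _ _ hx hy =>
    rw [Matrix.trace_add, scalarOf, map_add]
    exact add_mem hx hy
  | smul c x _ hx =>
    have : scalarOf K k m (c • x).trace = c • scalarOf K k m x.trace := by
      rw [Matrix.trace_smul, scalarOf, scalarOf, Algebra.smul_def, map_mul, Algebra.smul_def]
      rfl
    rw [this]
    exact Subalgebra.smul_mem _ hx c

lemma scalarOf_trace_mem_degLE {n : ℕ} {r : Mat K k m} (hr : r ∈ degLE K k m n) :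
    scalarOf K k m r.trace ∈ degLE K k m n := by
  intro p q
  rw [scalarOf, Matrix.algebraMap_matrix_apply]
  split_ifs
  · exact (totalDegree_finsetSum _ _).trans (Finset.sup_le fun j _ => hr j j)
  · simp

lemma card_le_growth {ι : Type*} [Fintype ι] {A : Subalgebra K (Mat K k m)} {n : ℕ}
    {f : ι → Mat K k m} (hA : ∀ i, f i ∈ A) (hn : ∀ i, f i ∈ degLE K k m n)
    (hf : LinearIndependent K f) : Fintype.card ι ≤ growth K k m A n := by
  have : Module.Finite K ↥(Subalgebra.toSubmodule A ⊓ degLE K k m n) :=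
    Submodule.finiteDimensional_of_le inf_le_right
  have h : LinearIndependent K fun i =>
      (⟨f i, hA i, hn i⟩ : ↥(Subalgebra.toSubmodule A ⊓ degLE K k m n)) :=
    LinearIndependent.of_comp (Submodule.subtype _) hf
  exact h.fintype_card_le_finrank

lemma growth_mono {A B : Subalgebra K (Mat K k m)} (h : A ≤ B) (n : ℕ) :
    growth K k m A n ≤ growth K k m B n := by
  have : Module.Finite K ↥(Subalgebra.toSubmodule B ⊓ degLE K k m n) :=
    Submodule.finiteDimensional_of_le inf_le_right
  exact Submodule.finrank_mono (inf_le_inf_right _ h)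

/-- Lower bounds for the growth of the generic matrix algebra and the pure trace algebra. -/
lemma pow_le_growth (hk : 2 ≤ k) (hm : 2 ≤ m) :
    ∃ D, ∀ N n, 1 ≤ N → D * N ≤ n →
      N ^ (k ^ 2 * (m - 1) + 1) ≤ growth K k m (Rkm K k m) n ∧
      N ^ (k ^ 2 * (m - 1) + 1) ≤ growth K k m (Ckm K k m) n := by
  classical
  set L := 3 * (m * (k * k) * (k + 1)) with hL
  refine ⟨(L + 1) * k + k + L, fun N n hN hn => ?_⟩
  have hi : (⟨1, by omega⟩ : Fin m) ≠ ⟨0, by omega⟩ := by simp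
  obtain ⟨E, hR, hdeg, hE⟩ := exists_linearIndependent_trace (K := K) hi
    (o := (⟨0, by omega⟩ : Fin k)) rfl N
  have hcard : Fintype.card ({v // v ∉ transversal (⟨0, by omega⟩ : Fin m) ⟨1, by omega⟩
      (⟨0, by omega⟩ : Fin k)} → Fin N) = N ^ (k ^ 2 * (m - 1) + 1) := by
    rw [Fintype.card_fun, Fintype.card_fin, ← Nat.card_eq_fintype_card,
      card_compl_transversal (by omega) hi]
  have hle : (3 * (m * (k * k) * (N * (k + 1))) + 1) * k + k * N +
      3 * (m * (k * k) * (N * (k + 1))) ≤ n := by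
    refine le_trans ?_ hn
    have : 3 * (m * (k * k) * (N * (k + 1))) = L * N := by rw [hL]; ring
    rw [this]
    nlinarith
  have hE' : LinearIndependent K E :=
    LinearIndependent.of_comp (Matrix.traceLinearMap (Fin k) K _) hE
  have hdeg' : ∀ δ, E δ ∈ degLE K k m n := fun δ => degLE_mono hle (hdeg δ)
  have : Nonempty (Fin k) := ⟨⟨0, by omega⟩⟩
  have hC : LinearIndependent K fun δ => scalarOf K k m (E δ).trace := by
    refine hE.map' (Algebra.linearMap (MvPolynomial (Fin m × Fin k × Fin k) K)
      (Mat K k m) |>.restrictScalars K) (LinearMap.ker_eq_bot.mpr ?_)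
    exact FaithfulSMul.algebraMap_injective _ _
  rw [← hcard]
  exact ⟨card_le_growth hR hdeg' hE', card_le_growth (fun δ => scalarOf_trace_mem_Ckm (hR δ))
    (fun δ => scalarOf_trace_mem_degLE (hdeg' δ)) hC⟩

end Growth

section Asymptotics

open Filter Topology

lemma tendsto_log_div_log_of_pow_le {g : ℕ → ℕ} {c d D : ℕ} (hup : ∀ n, g n ≤ c * (n + 1) ^ d)
    (hlow : ∀ N n, 1 ≤ N → D * N ≤ n → N ^ d ≤ g n) :
    Tendsto (fun n : ℕ => Real.log (g n) / Real.log n) atTop (𝓝 d) := by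
  have hlog : Tendsto (fun n : ℕ => Real.log n) atTop atTop :=
    Real.tendsto_log_atTop.comp tendsto_natCast_atTop_atTop
  have h0 : ∀ a : ℝ, Tendsto (fun n : ℕ => (d : ℝ) + a / Real.log n) atTop (𝓝 d) := fun a => by
    simpa using tendsto_const_nhds.add (hlog.const_div_atTop a)
  refine tendsto_of_tendsto_of_tendsto_of_le_of_le' (h0 (-(d * Real.log (2 * (D + 1)))))
    (h0 (Real.log c + d * Real.log 2)) ?_ ?_
  · filter_upwards [eventually_ge_atTop (2 * (D + 1))] with n hn
    have hn1 : (1 : ℝ) < n := by exact_mod_cast (by omega : 1 < n)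
    have hN : 1 ≤ n / (D + 1) := (Nat.one_le_div_iff (by omega)).mpr (by omega)
    have hDN : D * (n / (D + 1)) ≤ n :=
      (Nat.mul_le_mul_right _ (Nat.le_succ D)).trans (Nat.mul_div_le n (D + 1))
    have h1 : (n : ℝ) / (2 * (D + 1)) ≤ (n / (D + 1) : ℕ) := by
      rw [div_le_iff₀ (by positivity)]
      have := Nat.lt_mul_div_succ n (Nat.succ_pos D)
      have h2 : n ≤ n / (D + 1) * (2 * (D + 1)) := by
        simp only [Nat.succ_eq_add_one] at this
        nlinarith
      exact_mod_cast h2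
    have h3 : d * (Real.log n - Real.log (2 * (D + 1))) ≤ Real.log (g n) := by
      rw [← Real.log_div (by positivity) (by positivity), ← Real.log_pow]
      refine Real.log_le_log (by positivity) ((pow_le_pow_left₀ (by positivity) h1 d).trans ?_)
      exact_mod_cast hlow _ n hN hDN
    have hpos := Real.log_pos hn1
    rw [le_div_iff₀ hpos, add_mul, div_mul_cancel₀ _ hpos.ne']
    linarith
  · filter_upwards [eventually_ge_atTop (2 * (D + 1))] with n hn
    have hn1 : (1 : ℝ) < n := by exact_mod_cast (by omega : 1 < n)
    have hpos := Real.log_pos hn1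
    have hg : 0 < g n := lt_of_lt_of_le Nat.one_pos <| by
      simpa using hlow 1 n le_rfl (by omega)
    have hc : 0 < c := Nat.pos_of_ne_zero fun h => by
      have := hup n
      rw [h, zero_mul] at this
      omega
    have h1 : (g n : ℝ) ≤ c * (2 * n) ^ d := by
      have : g n ≤ c * (2 * n) ^ d :=
        (hup n).trans (Nat.mul_le_mul_left _ (Nat.pow_le_pow_left (by omega) d))
      exact_mod_cast this
    have h3 := Real.log_le_log (by exact_mod_cast hg) h1
    rw [Real.log_mul (by positivity) (by positivity), Real.log_pow,
      Real.log_mul (by positivity) (by positivity)] at h3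
    rw [div_le_iff₀ hpos, add_mul, div_mul_cancel₀ _ hpos.ne']
    linarith

end Asymptotics

/-- For `k, m ≥ 2`,
`GKdim(T_km) = GKdim(C_km) = GKdim(R_km) = k²(m−1) + 1`. -/
theorem stmt4 (K : Type) [Field K] [CharZero K] (k m : ℕ) (hk : 2 ≤ k) (hm : 2 ≤ m) :
    Filter.atTop.limsup
        (fun n : ℕ => Real.log (growth K k m (Tkm K k m) n) / Real.log n)
      = (k : ℝ) ^ 2 * ((m : ℝ) - 1) + 1 ∧
    Filter.atTop.limsup
        (fun n : ℕ => Real.log (growth K k m (Ckm K k m) n) / Real.log n)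
      = (k : ℝ) ^ 2 * ((m : ℝ) - 1) + 1 ∧
    Filter.atTop.limsup
        (fun n : ℕ => Real.log (growth K k m (Rkm K k m) n) / Real.log n)
      = (k : ℝ) ^ 2 * ((m : ℝ) - 1) + 1 := by
  have hi : (⟨1, by omega⟩ : Fin m) ≠ ⟨0, by omega⟩ := by simp
  have hT := growth_Tkm_le (K := K) (k := k) (by omega) hi
  have hRT : Rkm K k m ≤ Tkm K k m := le_sup_left
  have hCT : Ckm K k m ≤ Tkm K k m := le_sup_right
  obtain ⟨D, hD⟩ := pow_le_growth (K := K) hk hm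
  have hd : ((k ^ 2 * (m - 1) + 1 : ℕ) : ℝ) = (k : ℝ) ^ 2 * ((m : ℝ) - 1) + 1 := by
    push_cast [Nat.cast_sub (by omega : 1 ≤ m)]
    ring
  rw [← hd]
  refine ⟨(tendsto_log_div_log_of_pow_le (D := D) hT
      fun N n hN hn => (hD N n hN hn).1.trans (growth_mono hRT n)).limsup_eq,
    (tendsto_log_div_log_of_pow_le (fun n => (growth_mono hCT n).trans (hT n))
      fun N n hN hn => (hD N n hN hn).2).limsup_eq,
    (tendsto_log_div_log_of_pow_le (fun n => (growth_mono hRT n).trans (hT n))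
      fun N n hN hn => (hD N n hN hn).1).limsup_eq⟩
end
end
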